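/- For all positive integers η, n, d there exists an integer ηcA(n,d), independent of N and of K, such that: for every algebraically closed field K, every N, and every graded K-vector subspace V of R = K[x_1,…,x_N] of K-dimension at most n whose nonzero homogeneous elements are forms of positive degree at most d, if no nonzero homogeneous element of V lies in an ideal of R generated by ηcA(n,d) forms of strictly lower positive degree, then R/I satisfies Serre's condition R_η, where I is the ideal of R generated by V. -/

import Mathlib

open MvPolynomial

/-- The height of an ideal: the infimum of the heights of the prime ideals containing it
(so the unit ideal has height `⊤`). -/
noncomputable def idealHeight {R : Type*} [CommRing R] (I : Ideal R) : ℕ∞ :=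
  ⨅ (P : PrimeSpectrum R) (_ : I ≤ P.asIdeal), Order.height P

/-- A Noetherian local ring is regular if its maximal ideal is generated by
(Krull dimension)-many elements. -/
def IsRegularLocal (A : Type*) [CommRing A] [IsLocalRing A] : Prop :=
  IsNoetherianRing A ∧
    ∃ s : Finset A, Ideal.span (s : Set A) = IsLocalRing.maximalIdeal A ∧
      (s.card : WithBot ℕ∞) = ringKrullDim A

/-- Serre's condition `R_η` for a ring `A`: for every prime ideal `P` of `A` of height
at most `η`, the localization of `A` at `P` is a regular local ring. -/
def SerreConditionR (η : ℕ) (A : Type*) [CommRing A] : Prop :=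
  ∀ (P : Ideal A) [hP : P.IsPrime],
    Order.height (⟨P, hP⟩ : PrimeSpectrum A) ≤ (η : ℕ∞) →
      IsRegularLocal (Localization.AtPrime P)

/-- `G` is an `R_η`-sequence: it generates a proper ideal and the quotient of the ring by the
ideal generated by each initial segment satisfies Serre's condition `R_η`. -/
def IsRnSequence (η : ℕ) {R : Type*} [CommRing R] {s : ℕ} (G : Fin s → R) : Prop :=
  Ideal.span (Set.range G) ≠ ⊤ ∧
    ∀ i : ℕ, i ≤ s →
      SerreConditionR η (R ⧸ Ideal.span (G '' {j : Fin s | (j : ℕ) < i}))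

/-- `F`, a form of degree `d`, has a `k`-collapse: `F` lies in an ideal generated by
`k` forms of strictly smaller positive degree.  A form of degree `d` has strength at
least `s` iff it has no `s`-collapse. -/
def HasCollapse {K : Type*} [CommSemiring K] {σ : Type*} (d k : ℕ)
    (F : MvPolynomial σ K) : Prop :=
  ∃ (G : Fin k → MvPolynomial σ K) (e : Fin k → ℕ),
    (∀ i, 0 < e i ∧ e i < d ∧ (G i).IsHomogeneous (e i)) ∧
    F ∈ Ideal.span (Set.range G)

universe u

section Weights

variable {R J : Type*} [CommRing R] (w : J → ℕ)

/-- The polynomials all of whose monomials have weight less than `n`. -/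
noncomputable def weightLT (w : J → ℕ) (n : ℕ) : Submodule R (MvPolynomial J R) :=
  restrictSupport R {m | Finsupp.weight w m < n}

variable {w}

theorem mem_weightLT {n : ℕ} {f : MvPolynomial J R} :
    f ∈ weightLT w n ↔ ∀ m, coeff m f ≠ 0 → Finsupp.weight w m < n := by
  simp only [weightLT, mem_restrictSupport_iff, Set.subset_def, Finset.mem_coe, mem_support_iff,
    Set.mem_ofPred_eq]

theorem weightLT_mono {a b : ℕ} (h : a ≤ b) :
    (weightLT w a : Submodule R (MvPolynomial J R)) ≤ weightLT w b :=
  restrictSupport_mono R fun _ hm => lt_of_lt_of_le hm h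

theorem eq_zero_of_mem_weightLT_zero {f : MvPolynomial J R} (h : f ∈ weightLT w 0) : f = 0 := by
  ext m
  by_contra hm
  exact absurd (mem_weightLT.1 h m hm) (Nat.not_lt_zero _)

theorem mul_mem_weightLT {a b : ℕ} {f g : MvPolynomial J R} (hf : f ∈ weightLT w a)
    (hg : g ∈ weightLT w (b + 1)) : f * g ∈ weightLT w (a + b) := by
  classical
  rw [mem_weightLT] at *
  intro m hm
  obtain ⟨x, hx, y, hy, rfl⟩ :=
    Finset.mem_add.1 (support_mul f g (mem_support_iff.2 hm))
  have h1 := hf x (mem_support_iff.1 hx)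
  have h2 := hg y (mem_support_iff.1 hy)
  rw [map_add]
  omega

theorem C_mem_weightLT {n : ℕ} (hn : 0 < n) (c : R) : (C c : MvPolynomial J R) ∈ weightLT w n := by
  classical
  rw [mem_weightLT]
  intro m hm
  rw [coeff_C] at hm
  have : m = 0 := by
    by_contra h
    exact hm (if_neg fun h' => h h'.symm)
  simpa [this] using hn

theorem X_mem_weightLT (j : J) : (X j : MvPolynomial J R) ∈ weightLT w (w j + 1) := by
  classical
  rw [mem_weightLT]
  intro m hm
  rw [coeff_X] at hm
  have : Finsupp.single j 1 = m := by
    by_contra h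
    exact hm (if_neg h)
  rw [← this, Finsupp.weight_single]
  simp

theorem MvPolynomial.IsWeightedHomogeneous.mem_weightLT {n : ℕ} {f : MvPolynomial J R}
    (h : IsWeightedHomogeneous w f n) : f ∈ weightLT w (n + 1) :=
  _root_.mem_weightLT.2 fun m hm => by rw [h hm]; exact Nat.lt_succ_self n

theorem MvPolynomial.IsWeightedHomogeneous.eq_zero_of_mem_weightLT {n : ℕ} {f : MvPolynomial J R}
    (h : IsWeightedHomogeneous w f n) (h' : f ∈ weightLT w n) : f = 0 := by
  ext m
  by_contra hm
  exact absurd (h hm) (_root_.mem_weightLT.1 h' m hm).ne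

theorem exists_mem_weightLT (f : MvPolynomial J R) : ∃ n, f ∈ weightLT w n :=
  ⟨f.support.sup (Finsupp.weight w) + 1, mem_weightLT.2 fun _ hm =>
    Nat.lt_succ_of_le (Finset.le_sup (mem_support_iff.2 hm))⟩

theorem weight_le_of_single_add {m : J →₀ ℕ} {j : J} :
    Finsupp.weight w (m + Finsupp.single j 1) = Finsupp.weight w m + w j := by
  rw [map_add, Finsupp.weight_single, one_smul]

/-- Two algebra maps that do not raise weights and agree on variables up to lower weight agree on
all polynomials up to lower weight. -/
theorem aeval_mem_weightLT_and_sub_mem {A J' : Type*} [CommRing A] [Algebra R A] {w' : J' → ℕ} {n : ℕ}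
    {g g' : J → MvPolynomial J' A}
    (hg : ∀ j, w j ≤ n → g j ∈ weightLT w' (w j + 1))
    (hg' : ∀ j, w j ≤ n → g' j ∈ weightLT w' (w j + 1))
    (hd : ∀ j, w j ≤ n → g j - g' j ∈ weightLT w' (w j))
    {f : MvPolynomial J R} (hf : f ∈ weightLT w (n + 1)) :
    aeval g f ∈ weightLT w' (n + 1) ∧ aeval g f - aeval g' f ∈ weightLT w' n := by
  have key : ∀ m : J →₀ ℕ, Finsupp.weight w m ≤ n →
      aeval g (monomial m (1 : R)) ∈ weightLT w' (Finsupp.weight w m + 1) ∧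
      aeval g' (monomial m (1 : R)) ∈ weightLT w' (Finsupp.weight w m + 1) ∧
      aeval g (monomial m (1 : R)) - aeval g' (monomial m (1 : R)) ∈
        weightLT w' (Finsupp.weight w m) := by
    intro m
    induction m using Finsupp.induction_linear with
    | zero =>
      intro _
      have h1 : (monomial (0 : J →₀ ℕ) (1 : R)) = 1 := rfl
      rw [h1, map_one, map_one, sub_self, map_zero]
      exact ⟨C_mem_weightLT (by simp) 1, C_mem_weightLT (by simp) 1, zero_mem _⟩
    | add x y hx hy =>
      intro h
      rw [map_add] at h
      obtain ⟨a1, a2, a3⟩ := hx (by omega)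
      obtain ⟨b1, b2, b3⟩ := hy (by omega)
      have h1 : (monomial (x + y) (1 : R)) = monomial x 1 * monomial y 1 := by
        rw [monomial_mul, one_mul]
      rw [h1, map_mul, map_mul, map_add]
      refine ⟨?_, ?_, ?_⟩
      · rw [add_right_comm]; exact mul_mem_weightLT a1 b1
      · rw [add_right_comm]; exact mul_mem_weightLT a2 b2
      · set p := aeval g (monomial x (1 : R))
        set q := aeval g (monomial y (1 : R))
        set p' := aeval g' (monomial x (1 : R))
        set q' := aeval g' (monomial y (1 : R))
        have : p * q - p' * q' = (p - p') * q + (q - q') * p' := by ring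
        rw [this]
        refine add_mem (mul_mem_weightLT a3 b1) ?_
        rw [add_comm]
        exact mul_mem_weightLT b3 a2
    | single j c =>
      induction c with
      | zero =>
        intro _
        have h1 : (monomial (Finsupp.single j 0) (1 : R)) = 1 := by simp
        rw [h1, map_one, map_one, sub_self]
        exact ⟨C_mem_weightLT (by simp) 1, C_mem_weightLT (by simp) 1, zero_mem _⟩
      | succ c ih =>
        intro h
        rw [Finsupp.single_add, weight_le_of_single_add] at *
        obtain ⟨a1, a2, a3⟩ := ih (by omega)
        have b1 := hg j (by omega)
        have b2 := hg' j (by omega)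
        have b3 := hd j (by omega)
        have h1 : (monomial (Finsupp.single j c + Finsupp.single j 1) (1 : R)) =
            monomial (Finsupp.single j c) 1 * X j := by
          rw [X, monomial_mul, one_mul]
        rw [h1, map_mul, map_mul, aeval_X, aeval_X]
        refine ⟨?_, ?_, ?_⟩
        · rw [add_right_comm]; exact mul_mem_weightLT a1 b1
        · rw [add_right_comm]; exact mul_mem_weightLT a2 b2
        · set p := aeval g (monomial (Finsupp.single j c) (1 : R))
          set p' := aeval g' (monomial (Finsupp.single j c) (1 : R))
          have : p * g j - p' * g' j = (p - p') * g j + (g j - g' j) * p' := by ring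
          rw [this]
          refine add_mem (mul_mem_weightLT a3 b1) ?_
          rw [add_comm]
          exact mul_mem_weightLT b3 a2
  rw [f.as_sum, map_sum, map_sum, ← Finset.sum_sub_distrib]
  have h1 : ∀ m, (monomial m (coeff m f)) = coeff m f • monomial m (1 : R) := fun m => by
    rw [smul_monomial, smul_eq_mul, mul_one]
  refine ⟨sum_mem fun m hm => ?_, sum_mem fun m hm => ?_⟩ <;>
  have hm' := mem_weightLT.1 hf m (mem_support_iff.1 hm) <;>
  rw [h1, map_smul]
  · rw [← algebraMap_smul A]
    exact Submodule.smul_mem _ _ (weightLT_mono (by omega) (key m (by omega)).1)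
  · rw [map_smul, ← smul_sub, ← algebraMap_smul A]
    exact Submodule.smul_mem _ _ (weightLT_mono (Nat.le_of_lt_succ hm') (key m (by omega)).2.2)

theorem isWeightedHomogeneous_aeval {A J' : Type*} [CommRing A] [Algebra R A] {w' : J' → ℕ}
    {g : J → MvPolynomial J' A} (hg : ∀ j, IsWeightedHomogeneous w' (g j) (w j))
    {f : MvPolynomial J R} {n : ℕ} (hf : IsWeightedHomogeneous w f n) :
    IsWeightedHomogeneous w' (aeval g f) n := by
  rw [aeval_def, eval₂_eq]
  refine IsWeightedHomogeneous.sum _ _ _ fun m hm => ?_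
  rw [← hf (mem_support_iff.1 hm)]
  rw [← zero_add (Finsupp.weight w m)]
  refine IsWeightedHomogeneous.mul (isWeightedHomogeneous_C _ _) ?_
  rw [Finsupp.weight_apply, Finsupp.sum]
  exact IsWeightedHomogeneous.prod _ _ _ fun j _ => by
    simpa using (hg j).pow (m j)

end Weights

theorem exists_det_ne_zero {A ι : Type*} [CommRing A] [IsDomain A] {n : ℕ} (v : Fin n → ι → A)
    (h : ∀ a : Fin n → A, (∀ κ, ∑ j, a j * v j κ = 0) → ∀ j, a j = 0) :
    ∃ κ : Fin n → ι, (Matrix.of fun j l => v j (κ l)).det ≠ 0 := by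
  classical
  let L := FractionRing A
  let u : ι → (Fin n → L) := fun κ j => algebraMap A L (v j κ)
  have hspan : Submodule.span L (Set.range u) = ⊤ := by
    by_contra hne
    obtain ⟨f, hf, hf'⟩ := Submodule.exists_le_ker_of_lt_top _ (lt_top_iff_ne_top.2 hne)
    apply hf
    obtain ⟨b, hb⟩ := IsLocalization.exist_integer_multiples_of_finite (nonZeroDivisors A)
      (fun j : Fin n => f (Pi.single j 1))
    choose a ha using hb
    have hb0 : algebraMap A L b ≠ 0 := by
      simp
    have hfu : ∀ x : Fin n → L, f x = ∑ j, x j * f (Pi.single j 1) := by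
      intro x
      conv_lhs => rw [pi_eq_sum_univ' x]
      rw [map_sum]
      refine Finset.sum_congr rfl fun j _ => ?_
      rw [map_smul, smul_eq_mul]
    have ha0 : ∀ j, a j = 0 := by
      refine h a fun κ => ?_
      apply IsFractionRing.injective A L
      rw [map_zero, map_sum]
      have h0 : f (u κ) = 0 := hf' (Submodule.subset_span ⟨κ, rfl⟩)
      rw [hfu] at h0
      calc _ = algebraMap A L b * ∑ j, u κ j * f (Pi.single j 1) := by
            rw [Finset.mul_sum]
            refine Finset.sum_congr rfl fun j _ => ?_
            rw [map_mul, ha, Algebra.smul_def]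
            ring
        _ = 0 := by rw [h0, mul_zero]
    ext j
    have := ha j
    rw [ha0, map_zero, Algebra.smul_def] at this
    have := (mul_eq_zero.1 this.symm).resolve_left hb0
    simpa using this
  obtain ⟨s, a, ha, ha', hli⟩ := exists_linearIndependent' L u
  rw [hspan] at ha'
  let bs := Module.Basis.mk hli ha'.ge
  have : Fintype s := @Fintype.ofFinite _ (Module.Finite.finite_basis bs)
  have hc : Fintype.card s = n := by
    have := Module.finrank_eq_card_basis bs
    simpa using this.symm
  let e : Fin n ≃ s := (Fintype.equivFinOfCardEq hc).symm
  refine ⟨a ∘ e, fun h0 => ?_⟩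
  have hli' : LinearIndependent L (fun l => u (a (e l))) := hli.comp e e.injective
  have hu := (Matrix.linearIndependent_rows_iff_isUnit
    (A := Matrix.of fun l j => u (a (e l)) j)).1 hli'
  rw [Matrix.isUnit_iff_isUnit_det] at hu
  apply hu.ne_zero
  rw [← Matrix.det_transpose]
  have := congrArg (algebraMap A L) h0
  rw [map_zero, RingHom.map_det] at this
  exact this

section

variable {k J : Type*} [Field k]

/-- The ideal generated by a set of variables. -/
noncomputable def varIdeal (k : Type*) [Field k] {J : Type*} (V : Set J) : Ideal (MvPolynomial J k) :=
  Ideal.span (X '' V)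

open Classical in
/-- Setting a set of variables to zero. -/
noncomputable def killVars (k : Type*) [Field k] {J : Type*} (V : Set J) :
    MvPolynomial J k →ₐ[k] MvPolynomial J k :=
  aeval fun j => if j ∈ V then 0 else X j

theorem mem_varIdeal_iff {V : Set J} {f : MvPolynomial J k} :
    f ∈ varIdeal k V ↔ killVars k V f = 0 := by
  classical
  constructor
  · intro h
    have : varIdeal k V ≤ RingHom.ker (killVars k V) := by
      refine Ideal.span_le.2 ?_
      rintro _ ⟨j, hj, rfl⟩
      simp [killVars, RingHom.mem_ker, hj]
    exact this h
  · intro h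
    have : ∀ f : MvPolynomial J k, f - killVars k V f ∈ varIdeal k V := by
      intro f
      induction f using MvPolynomial.induction_on with
      | C a => simp [killVars]
      | add p q hp hq =>
        rw [map_add, add_sub_add_comm]
        exact add_mem hp hq
      | mul_X p j hp =>
        have hj : (X j : MvPolynomial J k) - killVars k V (X j) ∈ varIdeal k V := by
          by_cases hj : j ∈ V
          · have h : (X j : MvPolynomial J k) ∈ varIdeal k V := Ideal.subset_span ⟨j, hj, rfl⟩
            simpa [killVars, hj] using h
          · simp [killVars, hj]
        rw [map_mul, show p * X j - killVars k V p * killVars k V (X j) =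
          p * (X j - killVars k V (X j)) + killVars k V (X j) * (p - killVars k V p) by ring]
        exact add_mem (Ideal.mul_mem_left _ _ hj) (Ideal.mul_mem_left _ _ hp)
    have := this f
    rwa [h, sub_zero] at this

instance varIdeal_isPrime (V : Set J) : (varIdeal k V).IsPrime := by
  have : varIdeal k V = RingHom.ker (killVars k V) := by
    ext f
    exact mem_varIdeal_iff
  rw [this]
  exact RingHom.ker_isPrime _

theorem C_mem_varIdeal {V : Set J} {c : k} : (C c : MvPolynomial J k) ∈ varIdeal k V ↔ c = 0 := by
  rw [mem_varIdeal_iff]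
  simp [killVars]

/-- A derivation of positive weight decreases weights. -/
theorem Derivation.mem_weightLT {w : J → ℕ}
    (D : Derivation k (MvPolynomial J k) (MvPolynomial J k))
    (hD : ∀ j, D (X j) ∈ weightLT w (w j)) {f : MvPolynomial J k} {n : ℕ}
    (hf : f ∈ weightLT w (n + 1)) : D f ∈ weightLT w n := by
  have key : ∀ m : J →₀ ℕ,
      (monomial m (1 : k)) ∈ weightLT w (Finsupp.weight w m + 1) ∧
      D (monomial m (1 : k)) ∈ weightLT w (Finsupp.weight w m) := by
    intro m
    induction m using Finsupp.induction_linear with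
    | zero =>
      have h1 : (monomial (0 : J →₀ ℕ) (1 : k)) = 1 := rfl
      rw [h1, Derivation.map_one_eq_zero]
      exact ⟨C_mem_weightLT (by simp) 1, zero_mem _⟩
    | add x y hx hy =>
      have h1 : (monomial (x + y) (1 : k)) = monomial x 1 * monomial y 1 := by
        rw [monomial_mul, one_mul]
      rw [h1, map_add, Derivation.leibniz, smul_eq_mul, smul_eq_mul, mul_comm _ (D _),
        mul_comm _ (D _)]
      refine ⟨?_, add_mem ?_ ?_⟩
      · rw [add_right_comm]; exact mul_mem_weightLT hx.1 hy.1
      · rw [add_comm]; exact mul_mem_weightLT hy.2 hx.1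
      · exact mul_mem_weightLT hx.2 hy.1
    | single j c =>
      induction c with
      | zero =>
        have h1 : (monomial (Finsupp.single j 0) (1 : k)) = 1 := by simp
        rw [h1, Derivation.map_one_eq_zero]
        exact ⟨C_mem_weightLT (by simp) 1, zero_mem _⟩
      | succ c hx =>
        have h1 : (monomial (Finsupp.single j (c + 1)) (1 : k)) =
            monomial (Finsupp.single j c) 1 * X j := by
          rw [X, monomial_mul, one_mul, Finsupp.single_add]
        rw [h1, Derivation.leibniz, smul_eq_mul, smul_eq_mul, mul_comm _ (D _),
          mul_comm _ (D _), Finsupp.single_add, weight_le_of_single_add]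
        refine ⟨?_, add_mem ?_ ?_⟩
        · rw [add_right_comm]; exact mul_mem_weightLT hx.1 (X_mem_weightLT j)
        · rw [add_comm]; exact mul_mem_weightLT (hD j) hx.1
        · exact mul_mem_weightLT hx.2 (X_mem_weightLT j)
  rw [f.as_sum, map_sum]
  refine sum_mem fun m hm => ?_
  have hm' := _root_.mem_weightLT.1 hf m (mem_support_iff.1 hm)
  have h1 : (monomial m (coeff m f)) = coeff m f • monomial m (1 : k) := by
    rw [smul_monomial, smul_eq_mul, mul_one]
  rw [h1, map_smul]
  exact Submodule.smul_mem _ _ (weightLT_mono (Nat.le_of_lt_succ hm') (key m).2)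

theorem mem_weightLT_of_pow {w : J → ℕ} {p : ℕ} [Fact p.Prime] [CharP k p]
    {b : MvPolynomial J k} {n : ℕ} (h : b ^ p ∈ weightLT w (n + 2)) : b ∈ weightLT w (n + 1) := by
  rw [mem_weightLT] at *
  intro m hm
  have h1 : coeff (p • m) (b ^ p) = coeff m b ^ p := by
    rw [← map_frobenius_expand, coeff_map, coeff_expand_smul p (Fact.out : p.Prime).ne_zero,
      frobenius_def]
  have h2 := h (p • m) (by rw [h1]; exact pow_ne_zero _ hm)
  rw [map_nsmul, smul_eq_mul] at h2
  have := (Fact.out : p.Prime).two_le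
  nlinarith

end

section
variable {k J : Type u} [Field k]

/-- A family of derivations of a weighted polynomial ring that behaves like the family of
coordinate derivations of an infinite polynomial ring: variables are detected by their
derivatives and finitely many of the derivations have dual coordinates over a ring of
constants. -/
structure IsCoordinateFamily (w : J → ℕ) {ι : Type*}
    (D : ι → Derivation k (MvPolynomial J k) (MvPolynomial J k)) : Prop where
  homog : ∀ κ j, IsWeightedHomogeneous w (D κ (X j)) (w j - 1)
  pos : ∀ j, 0 < w j
  euler : ∀ (V : Finset J) (e : ℕ) (F : MvPolynomial J k), IsWeightedHomogeneous w F e →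
    (∀ κ, D κ F ∈ varIdeal k (V : Set J)) → (e : MvPolynomial J k) * F ∈ varIdeal k (V : Set J)
  coords : ∀ {m : ℕ} (κ : Fin m → ι), Function.Injective (fun l => D (κ l)) →
    ∃ (S : Subalgebra k (MvPolynomial J k)) (x : Fin m → MvPolynomial J k),
      (∀ l, ∀ a ∈ S, D (κ l) a = 0) ∧ (∀ μ, ∀ a ∈ S, D μ a ∈ S) ∧
      (∀ l l', D (κ l) (x l') = if l = l' then 1 else 0) ∧
      Algebra.adjoin S (Set.range x) = ⊤ ∧
      ∀ (p : ℕ) [Fact p.Prime] [CharP k p], ∀ a ∈ S, (∀ μ, D μ a = 0) → ∃ b ∈ S, b ^ p = a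

variable {w : J → ℕ} {ι : Type*} {D : ι → Derivation k (MvPolynomial J k) (MvPolynomial J k)}

theorem IsCoordinateFamily.X_mem (hD : IsCoordinateFamily w D) (κ : ι) (j : J) :
    D κ (X j) ∈ weightLT w (w j) := by
  have h := (hD.homog κ j).mem_weightLT
  rwa [Nat.sub_add_cancel (hD.pos j)] at h

theorem IsCoordinateFamily.eq_zero_of_mem (hD : IsCoordinateFamily w D)
    {S : Subalgebra k (MvPolynomial J k)} {p : ℕ} [Fact p.Prime] [CharP k p]
    (hS : ∀ μ, ∀ a ∈ S, D μ a ∈ S) (hS' : ∀ a ∈ S, (∀ μ, D μ a = 0) → ∃ b ∈ S, b ^ p = a)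
    {V : Set J} (hV : ∀ μ, ∀ a ∈ S, a ∈ varIdeal k V → D μ a ∈ varIdeal k V)
    {a : MvPolynomial J k} (ha : a ∈ S) (ha' : a ∈ varIdeal k V) : a = 0 := by
  obtain ⟨n, hn⟩ := exists_mem_weightLT (w := w) a
  induction n generalizing a with
  | zero => exact eq_zero_of_mem_weightLT_zero hn
  | succ n ih =>
    have h0 : ∀ μ, D μ a = 0 := fun μ =>
      ih (hS μ a ha) (hV μ a ha ha') ((D μ).mem_weightLT (hD.X_mem μ) hn)
    cases n with
    | zero =>
      have : a = C (coeff 0 a) := by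
        classical
        ext m
        rw [coeff_C]
        split_ifs with h
        · rw [h]
        · by_contra hm
          have hm' := mem_weightLT.1 hn m hm
          obtain ⟨j, hj⟩ := Finsupp.ne_iff.1 (Ne.symm h)
          have := Finsupp.le_weight w (hD.pos j).ne' m
          simp at hj
          omega
      rw [this] at ha' ⊢
      rw [C_mem_varIdeal.1 ha', C_0]
    | succ n =>
      obtain ⟨b, hb, rfl⟩ := hS' a ha h0
      rw [ih hb (Ideal.IsPrime.mem_of_pow_mem inferInstance _ ha') (mem_weightLT_of_pow hn),
        zero_pow (Fact.out : p.Prime).ne_zero]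

theorem Derivation.mem_varIdeal {V : Set J}
    (Δ : Derivation k (MvPolynomial J k) (MvPolynomial J k))
    (h : ∀ j ∈ V, Δ (X j) ∈ varIdeal k V) {f : MvPolynomial J k} (hf : f ∈ varIdeal k V) :
    Δ f ∈ varIdeal k V := by
  refine Submodule.span_induction (p := fun f _ => Δ f ∈ varIdeal k V) ?_ ?_ ?_ ?_ hf
  · rintro _ ⟨j, hj, rfl⟩
    exact h j hj
  · simp
  · intro x y _ _ hx hy
    rw [map_add]
    exact add_mem hx hy
  · intro a x hx h
    rw [smul_eq_mul, Derivation.leibniz]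
    exact add_mem (Ideal.mul_mem_left _ _ h) (Ideal.mul_mem_right _ _ hx)

/-- In a finite separable extension of characteristic `p`, every element is a combination of
linearly independent `p`-th powers. -/
theorem exists_sum_mul_pow {E L : Type u} [Field E] [Field L] [Algebra E L] [Module.Finite E L]
    [Algebra.IsSeparable E L] (p : ℕ) [Fact p.Prime] [CharP E p] (y : L) :
    ∃ (n : ℕ) (c : Fin n → E) (l : Fin n → L), LinearIndependent E (fun i => l i ^ p) ∧
      y = ∑ i, algebraMap E L (c i) * l i ^ p := by
  have : ExpChar E p := ExpChar.prime Fact.out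
  let b := (Module.finBasis E L).mapPowExpCharPowOfIsSeparable p 1
  have hb : ⇑b = fun i => Module.finBasis E L i ^ p := by
    ext i
    simp [b, Module.Basis.mapPowExpCharPowOfIsSeparable]
  refine ⟨_, fun i => b.repr y i, Module.finBasis E L, ?_, ?_⟩
  · rw [← hb]; exact b.linearIndependent
  · conv_lhs => rw [← b.sum_repr y]
    refine Finset.sum_congr rfl fun i _ => ?_
    rw [Algebra.smul_def, hb]

/-- Clearing denominators in `exists_sum_mul_pow`. -/
theorem exists_pow_mul_eq_sum {S A : Type u} [CommRing S] [IsDomain S] [CommRing A] [IsDomain A]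
    [Algebra S A] [FaithfulSMul S A] {m : ℕ} (x : Fin m → A)
    (hx : Algebra.adjoin S (Set.range x) = ⊤)
    (hΩ : ∀ (M : Type u) [AddCommGroup M] [Module A M] [Module S M] [IsScalarTower S A M]
      (δ : Derivation S A M), (∀ (a : A) (v : M), a • v = 0 → a = 0 ∨ v = 0) → δ = 0)
    (p : ℕ) [Fact p.Prime] [CharP S p] (y : A) :
    ∃ (n : ℕ) (c : Fin n → S) (g : Fin n → A) (b : S) (t : A), b ≠ 0 ∧ t ≠ 0 ∧
      y * (t * algebraMap S A b) ^ p = ∑ i, algebraMap S A (c i) * g i ^ p ∧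
      ∀ a : Fin n → S, ∑ i, algebraMap S A (a i) * g i ^ p = 0 → ∀ i, a i = 0 := by
  let E := FractionRing S
  let L := FractionRing A
  let : Algebra E L := FractionRing.liftAlgebra S L
  have : CharP E p := IsFractionRing.charP S p
  have : Algebra.FiniteType S A := by
    classical
    exact ⟨⟨Finset.univ.image x, by simpa using hx⟩⟩
  have : Algebra.EssFiniteType A L := .of_isLocalization _ (nonZeroDivisors A)
  have : Algebra.EssFiniteType S L := .comp S A L
  have : Algebra.EssFiniteType E L := .of_comp S E L
  have : Algebra.FormallyUnramified E L := by
    constructor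
    have hδ := hΩ (Ω[L⁄E]) (((KaehlerDifferential.D E L).restrictScalars S).compAlgebraMap A)
      fun a v h => by
        rw [← algebraMap_smul L, smul_eq_zero] at h
        simpa using h
    have h0 : ∀ a : A, KaehlerDifferential.D E L (algebraMap A L a) = 0 := fun a =>
      congrArg (fun δ => δ a) hδ
    have h1 : ∀ y : L, KaehlerDifferential.D E L y = 0 := by
      intro y
      obtain ⟨a, b, hb, rfl⟩ := IsFractionRing.div_surjective (A := A) y
      have hb' : algebraMap A L b ≠ 0 := by simpa using nonZeroDivisors.ne_zero hb
      have h := congrArg (KaehlerDifferential.D E L) (div_mul_cancel₀ (algebraMap A L a) hb')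
      rw [Derivation.leibniz, h0, h0, smul_zero, zero_add] at h
      exact (smul_eq_zero.1 h).resolve_left hb'
    rw [subsingleton_iff_forall_eq 0]
    intro v
    have hv : v ∈ Submodule.span L (Set.range (KaehlerDifferential.D E L)) := by
      rw [KaehlerDifferential.span_range_derivation]
      trivial
    have hr : Set.range (KaehlerDifferential.D E L) = {0} := by
      ext z
      simp [h1, eq_comm]
    rwa [hr, Submodule.span_zero_singleton, Submodule.mem_bot] at hv
  have : Module.Finite E L := Algebra.FormallyUnramified.finite_of_free E L
  have : Algebra.IsSeparable E L := (Algebra.FormallyUnramified.iff_isSeparable E L).1 inferInstance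
  obtain ⟨n, c, l, hli, hy⟩ := exists_sum_mul_pow (E := E) p (algebraMap A L y)
  obtain ⟨b, hb⟩ := IsLocalization.exist_integer_multiples_of_finite (nonZeroDivisors S) c
  obtain ⟨t, ht⟩ := IsLocalization.exist_integer_multiples_of_finite (nonZeroDivisors A) l
  choose c' hc using hb
  choose g hg using ht
  have hp : p ≠ 0 := (Fact.out : p.Prime).ne_zero
  have hb0 : (b : S) ≠ 0 := nonZeroDivisors.ne_zero b.2
  have ht0 : (t : A) ≠ 0 := nonZeroDivisors.ne_zero t.2
  have htower : ∀ s : S, algebraMap E L (algebraMap S E s) = algebraMap A L (algebraMap S A s) := by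
    intro s
    rw [← IsScalarTower.algebraMap_apply S E L, ← IsScalarTower.algebraMap_apply S A L]
  refine ⟨n, fun i => c' i * (b : S) ^ (p - 1), g, b, t, hb0, ht0, ?_, ?_⟩
  · apply IsFractionRing.injective A L
    simp only [map_mul, map_pow, map_sum, hy, hg, Finset.sum_mul]
    refine Finset.sum_congr rfl fun i _ => ?_
    rw [← htower, ← htower, hc, Algebra.smul_def, Algebra.smul_def, map_mul, mul_pow, mul_pow]
    obtain ⟨q, rfl⟩ := Nat.exists_eq_succ_of_ne_zero hp
    simp only [Nat.succ_eq_add_one, Nat.add_sub_cancel]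
    ring
  · intro a ha i
    have h := congrArg (algebraMap A L) ha
    simp only [map_mul, map_pow, map_sum, hg, map_zero, Algebra.smul_def, mul_pow,
      ← htower] at h
    have h2 : (algebraMap A L t) ^ p * ∑ i, algebraMap S E (a i) • l i ^ p = 0 := by
      rw [Finset.mul_sum, ← h]
      refine Finset.sum_congr rfl fun i _ => ?_
      rw [Algebra.smul_def]
      ring
    have h3 := (mul_eq_zero.1 h2).resolve_left (pow_ne_zero _ (by simp))
    have h4 := Fintype.linearIndependent_iff.1 hli _ h3 i
    simpa using h4

end

section
variable {k J : Type u} [Field k]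
variable {w : J → ℕ} {ι : Type*} {D : ι → Derivation k (MvPolynomial J k) (MvPolynomial J k)}

theorem Derivation.map_pow_char {A : Type*} [CommRing A] [Algebra k A] (p : ℕ) [CharP k p]
    (Δ : Derivation k A A) (a : A) : Δ (a ^ p) = 0 := by
  rw [Derivation.leibniz_pow, ← Nat.cast_smul_eq_nsmul k, CharP.cast_eq_zero, zero_smul]

theorem Derivation.finset_sum_apply {A κ : Type*} [CommRing A] [Algebra k A] (s : Finset κ)
    (Δ : κ → Derivation k A A) (a : A) : (∑ l ∈ s, Δ l) a = ∑ l ∈ s, Δ l a := by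
  classical
  induction s using Finset.induction_on with
  | empty => simp
  | insert i s hi ih => rw [Finset.sum_insert hi, Finset.sum_insert hi, Derivation.add_apply, ih]

theorem IsCoordinateFamily.exists_pow_mul_sub_pow_mem (hD : IsCoordinateFamily w D)
    {V : Finset J}
    (hT : ∀ a : J → MvPolynomial J k, (∀ κ, ∑ j ∈ V, a j * D κ (X j) ∈ varIdeal k (V : Set J)) →
      ∀ j ∈ V, a j ∈ varIdeal k (V : Set J))
    {F : MvPolynomial J k} (hF : ∀ κ, D κ F ∈ varIdeal k (V : Set J))
    (p : ℕ) [Fact p.Prime] [CharP k p] :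
    ∃ h g : MvPolynomial J k, h ∉ varIdeal k (V : Set J) ∧
      h ^ p * F - g ^ p ∈ varIdeal k (V : Set J) := by
  classical
  set P : Ideal (MvPolynomial J k) := varIdeal k (V : Set J) with hP
  have hPp : P.IsPrime := varIdeal_isPrime _
  let A := MvPolynomial J k ⧸ P
  let e := V.equivFin
  let mk : MvPolynomial J k →+* A := Ideal.Quotient.mk P
  have mk0 : ∀ f, mk f = 0 ↔ f ∈ P := fun f => Ideal.Quotient.eq_zero_iff_mem
  obtain ⟨κ, hκ⟩ := exists_det_ne_zero (A := A) (fun j κ => mk (D κ (X (e.symm j : J)))) (by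
    intro a ha j
    choose b hb using fun j => Ideal.Quotient.mk_surjective (I := P) (a j)
    have := hT (fun j => if h : j ∈ V then b (e ⟨j, h⟩) else 0) (fun κ => by
      rw [← mk0, map_sum, ← ha κ, ← V.sum_coe_sort, ← e.symm.sum_comp]
      refine Finset.sum_congr rfl fun j _ => ?_
      rw [map_mul]
      congr 1
      simp [← hb, mk]) (e.symm j) (e.symm j).2
    rw [← mk0] at this
    simpa [mk, hb] using this)
  set M : Matrix (Fin V.card) (Fin V.card) (MvPolynomial J k) :=
    Matrix.of fun j l => D (κ l) (X (e.symm j : J)) with hM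
  have hdet : M.det ∉ P := by
    rw [← mk0, RingHom.map_det]
    exact hκ
  have hinj : Function.Injective fun l => D (κ l) := by
    intro l l' h
    by_contra hne
    apply hκ
    refine Matrix.det_zero_of_column_eq hne fun j => ?_
    have h : D (κ l) = D (κ l') := h
    simp [h]
  obtain ⟨S, x, hS0, hS, hx, hgen, hroot⟩ := hD.coords κ hinj
  have hΔ : ∀ μ, ∃ Δ : Derivation k (MvPolynomial J k) (MvPolynomial J k),
      (∀ f ∈ P, Δ f ∈ P) ∧ (Δ F ∈ P) ∧ ∀ a ∈ S, Δ a = M.det * D μ a := by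
    intro μ
    let v : Fin V.card → MvPolynomial J k := fun j => D μ (X (e.symm j : J))
    let c := M.adjugate.mulVec v
    have hc : M.mulVec c = M.det • v := by
      rw [Matrix.mulVec_mulVec, Matrix.mul_adjugate, Matrix.smul_mulVec, Matrix.one_mulVec]
    refine ⟨M.det • D μ - ∑ l, c l • D (κ l), fun f hf => ?_, ?_, ?_⟩
    · refine Derivation.mem_varIdeal _ (fun j hj => ?_) hf
      have h := congrFun hc (e ⟨j, hj⟩)
      simp only [Matrix.mulVec, dotProduct, hM, Matrix.of_apply, Equiv.symm_apply_apply,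
        Pi.smul_apply, v] at h
      convert zero_mem (varIdeal k (V : Set J))
      rw [Derivation.sub_apply, Derivation.smul_apply, ← h, sub_eq_zero, Derivation.finset_sum_apply]
      refine Finset.sum_congr rfl fun l _ => ?_
      rw [Derivation.smul_apply, smul_eq_mul, mul_comm]
    · rw [Derivation.sub_apply, Derivation.smul_apply, Derivation.finset_sum_apply]
      refine sub_mem (Ideal.mul_mem_left _ _ (hF μ)) (sum_mem fun l _ => ?_)
      rw [Derivation.smul_apply]
      exact Ideal.mul_mem_left _ _ (hF _)
    · intro a ha
      rw [Derivation.sub_apply, Derivation.smul_apply, Derivation.finset_sum_apply, smul_eq_mul]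
      simp only [Derivation.smul_apply, hS0 _ a ha, smul_zero, Finset.sum_const_zero, sub_zero]
  have hSP : ∀ a ∈ S, a ∈ P → a = 0 := by
    intro a ha ha'
    refine hD.eq_zero_of_mem hS (hroot p) (fun μ a ha haP => ?_) ha ha'
    obtain ⟨Δ, h1, -, h3⟩ := hΔ μ
    have := h1 a haP
    rw [h3 a ha] at this
    exact (hPp.mem_or_mem this).resolve_left hdet
  have hinjS : Function.Injective (algebraMap S A) := by
    rw [injective_iff_map_eq_zero]
    rintro ⟨a, ha⟩ h
    exact Subtype.ext (hSP a ha ((mk0 a).1 h))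
  have : FaithfulSMul S A := (faithfulSMul_iff_algebraMap_injective S A).2 hinjS
  have : CharP S p := charP_of_injective_algebraMap (algebraMap k S).injective p
  obtain ⟨n, c, g, b, t, hb, ht, hy, hli⟩ := exists_pow_mul_eq_sum (S := S) (A := A)
    (fun l => mk (x l)) (by
      have h := Algebra.map_top (Ideal.Quotient.mkₐ S P)
      rw [← hgen, AlgHom.map_adjoin, (AlgHom.range_eq_top _).2 (Ideal.Quotient.mkₐ_surjective S P),
        ← Set.range_comp] at h
      exact h) (by
      intro N _ _ _ _ δ htf
      have hz : ∀ v : N, mk 0 • v = 0 := fun v =>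
        (congrArg (· • v) (map_zero mk)).trans (zero_smul A v)
      have key : ∀ f : MvPolynomial J k, δ (mk f) = ∑ l, mk (D (κ l) f) • δ (mk (x l)) := by
        intro f
        have hf : f ∈ Algebra.adjoin S (Set.range x) := by rw [hgen]; trivial
        induction hf using Algebra.adjoin_induction with
        | mem y hy =>
          obtain ⟨l, rfl⟩ := hy
          rw [Finset.sum_eq_single l]
          · rw [hx, if_pos rfl, map_one, one_smul]
          · intro l' _ hne
            rw [hx, if_neg hne, hz]
          · exact fun h => absurd (Finset.mem_univ l) h
        | algebraMap s =>
          have h1 : δ (mk (algebraMap S _ s)) = 0 := δ.map_algebraMap s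
          rw [h1]
          have : ∀ l, D (κ l) (algebraMap S (MvPolynomial J k) s) = 0 := fun l => hS0 l s s.2
          simp only [this, hz, Finset.sum_const_zero]
        | add f g _ _ hf hg =>
          simp only [map_add, hf, hg, add_smul, Finset.sum_add_distrib]
        | mul f g _ _ hf hg =>
          simp only [map_mul, Derivation.leibniz, hf, hg, map_add, add_smul,
            Finset.sum_add_distrib, smul_eq_mul, mul_smul, Finset.smul_sum]
      let v : Fin V.card → N := fun l => δ (mk (x l))
      have hv : ∀ l, v l = 0 := by
        have h1 : ∀ j, ∑ l, mk (M j l) • v l = 0 := by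
          intro j
          have h := key (X (e.symm j : J))
          have hX : mk (X (e.symm j : J)) = 0 := by
            rw [mk0]
            exact Ideal.subset_span ⟨_, (e.symm j).2, rfl⟩
          rw [hX, map_zero] at h
          exact h.symm
        intro l
        have h2 : mk M.det • v l = 0 := by
          have h3 : ∑ j, mk (M.adjugate l j) • ∑ l', mk (M j l') • v l' = 0 := by
            simp [h1]
          simp only [Finset.smul_sum, smul_smul, ← map_mul] at h3
          rw [Finset.sum_comm] at h3
          simp only [← Finset.sum_smul, ← map_sum, ← Matrix.mul_apply, Matrix.adjugate_mul] at h3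
          rw [Finset.sum_eq_single l] at h3
          · simpa using h3
          · intro l' _ hne
            rw [Matrix.smul_apply, Matrix.one_apply_ne hne.symm, smul_zero, hz]
          · exact fun h => absurd (Finset.mem_univ l) h
        exact (htf _ _ h2).resolve_left (by rw [mk0]; exact hdet)
      ext a
      obtain ⟨f, rfl⟩ := Ideal.Quotient.mk_surjective a
      have h := key f
      simp only [v] at hv
      simpa [hv] using h) p (mk F)
  choose g' hg' using fun i => Ideal.Quotient.mk_surjective (I := P) (g i)
  obtain ⟨t', rfl⟩ := Ideal.Quotient.mk_surjective (I := P) t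
  have hbP : (b : MvPolynomial J k) ∉ P := fun h => hb (Subtype.ext (hSP b b.2 h))
  have htP : t' ∉ P := fun h => ht ((mk0 t').2 h)
  have hp : p ≠ 0 := (Fact.out : p.Prime).ne_zero
  have hmem : F * (t' * b) ^ p - ∑ i, (c i : MvPolynomial J k) * g' i ^ p ∈ P := by
    rw [← mk0, map_sub, sub_eq_zero, map_mul, map_pow, map_mul, map_sum]
    refine hy.trans (Finset.sum_congr rfl fun i _ => ?_)
    rw [map_mul, map_pow, ← hg']
    rfl
  have hc0 : ∀ μ i, D μ (c i) = 0 := by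
    intro μ i
    obtain ⟨Δ, h1, h2, h3⟩ := hΔ μ
    have h4 := h1 _ hmem
    rw [map_sub, Derivation.leibniz, Derivation.map_pow_char, smul_zero, zero_add, map_sum] at h4
    have h5 : M.det * ∑ i, D μ (c i) * g' i ^ p ∈ P := by
      rw [Finset.mul_sum]
      have h6 := sub_mem (Ideal.mul_mem_left P ((t' * b) ^ p) h2) h4
      rw [smul_eq_mul, sub_sub_cancel] at h6
      convert h6 using 1
      refine Finset.sum_congr rfl fun i _ => ?_
      rw [Derivation.leibniz, Derivation.map_pow_char, smul_zero, zero_add, h3 _ (c i).2,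
        smul_eq_mul]
      ring
    have h7 := (hPp.mem_or_mem h5).resolve_left hdet
    rw [← mk0, map_sum] at h7
    have h8 := hli (fun i => ⟨D μ (c i), hS μ _ (c i).2⟩) (by
      rw [← h7]
      refine Finset.sum_congr rfl fun i _ => ?_
      rw [map_mul, map_pow, ← hg']
      rfl) i
    exact congrArg Subtype.val h8
  choose r _ hr using fun i => hroot p (c i) (c i).2 fun μ => hc0 μ i
  refine ⟨t' * b, ∑ i, r i * g' i, fun h => ?_, ?_⟩
  · exact (hPp.mem_or_mem h).elim htP hbP
  · rw [sum_pow_char p]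
    simp only [mul_pow, hr] at hmem ⊢
    rwa [mul_comm]

end

section
variable {k J : Type u} [Field k]
variable {w : J → ℕ} {ι : Type*} {D : ι → Derivation k (MvPolynomial J k) (MvPolynomial J k)}

/-- A point of a prime ideal on the finitely many variables involved in its generators. -/
theorem exists_partial_eval [IsAlgClosed k] {P : Ideal (MvPolynomial J k)} [hP : P.IsPrime]
    (hfg : P.FG) (s : Finset J) (a : J → MvPolynomial J k) {j₀ : J} (hj₀ : j₀ ∈ s)
    (ha : a j₀ ∉ P) :
    ∃ (V : Finset J) (α : J → k) (β : J → k), β j₀ ≠ 0 ∧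
      ∀ Φ : MvPolynomial J k →ₐ[k] MvPolynomial J k, (∀ j ∈ V, Φ (X j) = C (α j)) →
        (∀ f ∈ P, Φ f = 0) ∧ ∀ j ∈ s, Φ (a j) = C (β j) := by
  classical
  obtain ⟨G, rfl⟩ := hfg
  set P := Ideal.span (G : Set (MvPolynomial J k)) with hPdef
  let V : Finset J := G.biUnion vars ∪ s.biUnion fun j => (a j).vars
  let r : MvPolynomial V k →ₐ[k] MvPolynomial J k := rename Subtype.val
  have hr : ∀ f : MvPolynomial J k, f.vars ⊆ V → ∃ g, r g = f := by
    intro f hf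
    have : f ∈ supported k (V : Set J) := mem_supported.2 (by exact_mod_cast hf)
    rw [supported_eq_range_rename] at this
    exact this
  have hG : ∀ f ∈ G, f.vars ⊆ V := fun f hf =>
    (Finset.subset_biUnion_of_mem vars hf).trans Finset.subset_union_left
  have hA : ∀ j ∈ s, (a j).vars ⊆ V := fun j hj =>
    (Finset.subset_biUnion_of_mem (fun j => (a j).vars) hj).trans Finset.subset_union_right
  choose! b hb using fun j hj => hr (a j) (hA j hj)
  have hprime : (P.comap r).IsPrime := Ideal.IsPrime.comap r
  have hnot : b j₀ ∉ vanishingIdeal k (zeroLocus k (P.comap r)) := by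
    rw [IsPrime.vanishingIdeal_zeroLocus, Ideal.mem_comap]
    rwa [hb j₀ hj₀]
  rw [mem_vanishingIdeal_iff] at hnot
  push Not at hnot
  obtain ⟨x, hx, hx0⟩ := hnot
  refine ⟨V, fun j => if h : j ∈ V then x ⟨j, h⟩ else 0, fun j => aeval x (b j), hx0, ?_⟩
  intro Φ hΦ
  have key : ∀ g, Φ (r g) = C (aeval x g) := by
    have : Φ.comp r = (Algebra.ofId k (MvPolynomial J k)).comp (aeval x) := by
      ext j
      simp only [AlgHom.comp_apply, r, rename_X, aeval_X]
      rw [hΦ j j.2]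
      simp [Algebra.ofId_apply]
    intro g
    exact congrArg (fun f => f g) this
  constructor
  · have : P ≤ RingHom.ker Φ := by
      refine Ideal.span_le.2 fun f hf => ?_
      obtain ⟨g, rfl⟩ := hr f (hG f hf)
      have : aeval x g = 0 := mem_zeroLocus_iff.1 hx g (Ideal.subset_span hf)
      simp [RingHom.mem_ker, key, this]
    exact fun f hf => this hf
  · intro j hj
    rw [← hb j hj, key]

theorem IsCoordinateFamily.mem_of_sum_mem [IsAlgClosed k] (hD : IsCoordinateFamily w D)
    {P : Ideal (MvPolynomial J k)} (hP : P.IsPrime) (hfg : P.FG)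
    {s : Finset J} {a : J → MvPolynomial J k} (ha : ∀ κ, ∑ j ∈ s, a j * D κ (X j) ∈ P) :
    ∀ j ∈ s, a j ∈ P := by
  classical
  obtain ⟨n, hn⟩ : ∃ n, ∀ j ∈ s, w j < n := ⟨s.sup w + 1, fun j hj =>
    Nat.lt_succ_of_le (Finset.le_sup hj)⟩
  induction n generalizing s P a with
  | zero => exact fun j hj => absurd (hn j hj) (Nat.not_lt_zero _)
  | succ n ih =>
    by_contra! hcon
    obtain ⟨j₀, hj₀, ha₀⟩ := hcon
    obtain ⟨V, α, β, hβ, hΦ⟩ := exists_partial_eval hfg s a hj₀ ha₀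
    obtain ⟨j₁, hj₁, hmax⟩ := (s.filter fun j => β j ≠ 0).exists_max_image w
      ⟨j₀, by simp [hj₀, hβ]⟩
    simp only [Finset.mem_filter] at hj₁ hmax
    set e := w j₁ with he
    have hepos : 0 < e := hD.pos j₁
    let V₀ := V.filter fun j => w j < e
    let F : MvPolynomial J k := ∑ j ∈ s with w j = e, C (β j) * X j
    let Φ : MvPolynomial J k →ₐ[k] MvPolynomial J k :=
      aeval fun j => if j ∈ V then C (α j) else X j
    obtain ⟨hΦP, hΦa⟩ := hΦ Φ (fun j hj => by simp [Φ, hj])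
    have hFhom : IsWeightedHomogeneous w F e := by
      refine IsWeightedHomogeneous.sum _ _ _ fun j hj => ?_
      rw [← (Finset.mem_filter.1 hj).2, ← zero_add (w j)]
      exact (isWeightedHomogeneous_C _ _).mul (isWeightedHomogeneous_X _ _ _)
    have hDF : ∀ κ, D κ F = ∑ j ∈ s with w j = e, C (β j) * D κ (X j) := by
      intro κ
      rw [map_sum]
      refine Finset.sum_congr rfl fun j _ => ?_
      rw [← smul_eq_C_mul, Derivation.map_smul, smul_eq_C_mul]
    have hpd : pderiv j₁ F = C (β j₁) := by
      rw [map_sum, Finset.sum_eq_single j₁]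
      · rw [pderiv_C_mul, pderiv_X_self, mul_one]
      · intro j _ hne
        rw [pderiv_C_mul, pderiv_X_of_ne hne, mul_zero]
      · intro h
        exact absurd (Finset.mem_filter.2 ⟨hj₁.1, he.symm⟩) h
    have hpdP : ∀ f ∈ varIdeal k (V₀ : Set J), pderiv j₁ f ∈ varIdeal k (V₀ : Set J) := by
      intro f hf
      refine Derivation.mem_varIdeal _ (fun j hj => ?_) hf
      have hne : j ≠ j₁ := by
        rintro rfl
        exact lt_irrefl _ (Finset.mem_filter.1 hj).2
      rw [pderiv_X_of_ne hne]
      exact zero_mem _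
    have hβ₁ : C (β j₁) ∉ varIdeal k (V₀ : Set J) := fun h => hj₁.2 (C_mem_varIdeal.1 h)
    have hF0 : ∀ κ, D κ F ∈ varIdeal k (V₀ : Set J) := by
      intro κ
      rw [mem_varIdeal_iff]
      have hhom : IsWeightedHomogeneous w (killVars k (V₀ : Set J) (D κ F)) (e - 1) := by
        refine isWeightedHomogeneous_aeval (w := w) (fun j => ?_) ?_
        · split_ifs
          · exact isWeightedHomogeneous_zero _ _ _
          · exact isWeightedHomogeneous_X _ _ _
        · rw [hDF]
          refine IsWeightedHomogeneous.sum _ _ _ fun j hj => ?_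
          rw [← (Finset.mem_filter.1 hj).2, ← zero_add (w j - 1)]
          exact (isWeightedHomogeneous_C _ _).mul (hD.homog _ _)
      refine hhom.eq_zero_of_mem_weightLT ?_
      have hdiff : ∀ f ∈ weightLT w ((e - 1) + 1),
          Φ f ∈ weightLT w ((e - 1) + 1) ∧ Φ f - killVars k (V₀ : Set J) f ∈ weightLT w (e - 1) := by
        intro f hf
        refine aeval_mem_weightLT_and_sub_mem (fun j _ => ?_) (fun j _ => ?_) (fun j hj => ?_) hf
        · split_ifs
          · exact C_mem_weightLT (Nat.succ_pos _) _
          · exact X_mem_weightLT j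
        · split_ifs
          · exact zero_mem _
          · exact X_mem_weightLT j
        · have : j ∈ (V₀ : Set J) ↔ j ∈ V := by
            simp only [V₀, Finset.coe_filter, Set.mem_ofPred_eq]
            exact ⟨fun h => h.1, fun h => ⟨h, by omega⟩⟩
          simp only [this]
          split_ifs
          · rw [sub_zero]
            exact C_mem_weightLT (hD.pos j) _
          · rw [sub_self]
            exact zero_mem _
      have hsum : ∑ j ∈ s, C (β j) * Φ (D κ (X j)) = 0 := by
        rw [← hΦP _ (ha κ), map_sum]
        refine Finset.sum_congr rfl fun j hj => ?_
        rw [map_mul, hΦa j hj]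
      rw [hDF, map_sum]
      rw [← Finset.sum_filter_add_sum_filter_not s (fun j => w j = e)] at hsum
      have h1 : ∑ j ∈ s with ¬ w j = e, C (β j) * Φ (D κ (X j)) ∈ weightLT w (e - 1) := by
        refine sum_mem fun j hj => ?_
        obtain ⟨hjs, hje⟩ := Finset.mem_filter.1 hj
        by_cases hb : β j = 0
        · rw [hb, C_0, zero_mul]
          exact zero_mem _
        have hlt : w j < e := lt_of_le_of_ne (hmax j ⟨hjs, hb⟩) hje
        rw [← smul_eq_C_mul]
        refine Submodule.smul_mem _ _ ?_
        have h2 := (hD.X_mem κ j)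
        have h3 := aeval_mem_weightLT_and_sub_mem (n := w j - 1) (w' := w)
          (g := fun j => if j ∈ V then C (α j) else X j)
          (g' := fun j => if j ∈ V then C (α j) else X j) (fun j _ => ?_) (fun j _ => ?_)
          (fun j _ => by rw [sub_self]; exact zero_mem _)
          (f := D κ (X j)) (by rwa [Nat.sub_add_cancel (hD.pos j)])
        · exact weightLT_mono (show w j - 1 + 1 ≤ e - 1 by have := hD.pos j; omega) h3.1
        all_goals
          split_ifs
          · exact C_mem_weightLT (Nat.succ_pos _) _
          · exact X_mem_weightLT j
      have h2 : ∑ j ∈ s with w j = e, C (β j) * Φ (D κ (X j)) ∈ weightLT w (e - 1) := by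
        rw [eq_neg_of_add_eq_zero_left hsum]
        exact neg_mem h1
      rw [← sub_sub_self (∑ j ∈ s with w j = e, C (β j) * Φ (D κ (X j))) (Finset.sum _ _)]
      refine sub_mem h2 ?_
      rw [← Finset.sum_sub_distrib]
      refine sum_mem fun j hj => ?_
      rw [map_mul, show killVars k (V₀ : Set J) (C (β j)) = C (β j) from AlgHom.commutes _ _,
        ← mul_sub, ← smul_eq_C_mul]
      refine Submodule.smul_mem _ _ (hdiff _ ?_).2
      have h3 := hD.X_mem κ j
      rwa [(Finset.mem_filter.1 hj).2, ← Nat.sub_add_cancel hepos] at h3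
    by_cases hek : (e : k) = 0
    · have hp0 : ringChar k ≠ 0 := fun h => by
        have := (ringChar.spec k e).1 hek
        rw [h, zero_dvd_iff] at this
        omega
      have : Fact (ringChar k).Prime := ⟨(CharP.char_is_prime_or_zero k _).resolve_right hp0⟩
      obtain ⟨h, g, hh, hg⟩ := hD.exists_pow_mul_sub_pow_mem (V := V₀)
        (fun a ha => ih (varIdeal_isPrime _) ⟨V₀.image X, by simp [varIdeal]⟩ ha
          (fun j hj => by
            have h1 := (Finset.mem_filter.1 hj).2
            have h2 := hn j₁ hj₁.1
            omega)) hF0 (ringChar k)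
      have h1 := hpdP _ hg
      rw [map_sub, Derivation.leibniz, Derivation.map_pow_char, Derivation.map_pow_char, smul_zero,
        add_zero, sub_zero, hpd, smul_eq_mul] at h1
      exact ((varIdeal_isPrime (V₀ : Set J)).mem_or_mem h1).elim
        (fun h2 => hh (Ideal.IsPrime.mem_of_pow_mem inferInstance _ h2)) hβ₁
    · have h1 := hpdP _ (Ideal.mul_mem_left _ (C (e : k)⁻¹) (hD.euler V₀ e F hFhom hF0))
      rw [← mul_assoc, ← map_natCast (C : k →+* MvPolynomial J k), ← C_mul, inv_mul_cancel₀ hek,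
        C_1, one_mul, hpd] at h1
      exact hβ₁ h1

end

section
variable {k J : Type u} [Field k]

theorem isPrime_map_rename_subtype {k J : Type*} [Field k] (V : Set J) {p : Ideal (MvPolynomial V k)} (hp : p.IsPrime) :
    (p.map (rename Subtype.val : MvPolynomial V k →ₐ[k] MvPolynomial J k)).IsPrime := by
  classical
  let e : MvPolynomial (Vᶜ : Set J) (MvPolynomial V k) ≃ₐ[k] MvPolynomial J k :=
    (sumAlgEquiv k (Vᶜ : Set J) V).symm.trans
      (renameEquiv k <| (Equiv.sumComm (Vᶜ : Set J) V).trans <| Equiv.Set.sumCompl V)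
  have he : (rename Subtype.val : MvPolynomial V k →ₐ[k] MvPolynomial J k).toRingHom =
      (e.toRingEquiv : MvPolynomial (Vᶜ : Set J) (MvPolynomial V k) →+* MvPolynomial J k).comp C := by
    have : (rename Subtype.val : MvPolynomial V k →ₐ[k] MvPolynomial J k) =
        e.toAlgHom.comp (Algebra.algHom _ (MvPolynomial V k) _) := by
      apply algHom_ext
      simp [e, rename, X, monomial, Algebra.algHom, renameEquiv, Finsupp.mapDomain.addMonoidHom,
        sumAlgEquiv, C]
    rw [this]
    rfl
  have hpC : (p.map (C : MvPolynomial V k →+* MvPolynomial (Vᶜ : Set J) _)).IsPrime := by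
    rw [← Ideal.Quotient.isDomain_iff_prime]
    exact (quotientEquivQuotientMvPolynomial (σ := (Vᶜ : Set J)) p).symm.toMulEquiv.isDomain _
  change (p.map (rename Subtype.val : MvPolynomial V k →ₐ[k] MvPolynomial J k).toRingHom).IsPrime
  rw [he, ← Ideal.map_map]
  exact Ideal.map_isPrime_of_equiv e.toRingEquiv

attribute [local instance] algebraMvPolynomial in
theorem exists_finset_of_surjective {S A : Type*} [CommRing S] [IsDomain S] [CommRing A]
    [Algebra S A] {m : ℕ} {x : Fin m → A}
    (hx : Function.Surjective (aeval x : MvPolynomial (Fin m) S →ₐ[S] A)) (P : Ideal A) :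
    ∃ G : Finset A, (G : Set A) ⊆ P ∧
      ∀ f ∈ P, ∃ t : S, t ≠ 0 ∧ algebraMap S A t * f ∈ Ideal.span (G : Set A) := by
  classical
  let π : MvPolynomial (Fin m) S →ₐ[S] A := aeval x
  let B' := MvPolynomial (Fin m) (FractionRing S)
  let Q := P.comap π
  obtain ⟨s, hs, hs'⟩ := (Submodule.fg_span_iff_fg_span_finset_subset _).1
    (IsNoetherian.noetherian (Q.map (algebraMap (MvPolynomial (Fin m) S) B')))
  obtain ⟨T, hT, rfl⟩ := Finset.subset_set_image_iff.1 hs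
  refine ⟨T.image π, ?_, ?_⟩
  · intro f hf
    obtain ⟨g, hg, rfl⟩ := Finset.mem_image.1 hf
    exact hT hg
  · intro f hf
    obtain ⟨f, rfl⟩ := hx f
    have h1 : algebraMap _ B' f ∈ (Ideal.span (T : Set (MvPolynomial (Fin m) S))).map
        (algebraMap _ B') := by
      rw [Ideal.map_span]
      have : algebraMap _ B' f ∈ Q.map (algebraMap _ B') := Ideal.mem_map_of_mem _ hf
      rw [Finset.coe_image] at hs'
      exact (show Ideal.span _ = Ideal.span _ from hs') ▸ this
    rw [IsLocalization.algebraMap_mem_map_algebraMap_iff ((nonZeroDivisors S).map C)] at h1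
    obtain ⟨_, ⟨t, ht, rfl⟩, h1⟩ := h1
    refine ⟨t, nonZeroDivisors.ne_zero ht, ?_⟩
    have h2 := Ideal.mem_map_of_mem π h1
    rw [Ideal.map_span, map_mul] at h2
    rw [Finset.coe_image]
    convert h2
    exact (aeval_C x t).symm

theorem fg_of_disjoint {P : Ideal (MvPolynomial J k)} (hP : P.IsPrime)
    (S : Subalgebra k (MvPolynomial J k)) {m : ℕ} (x : Fin m → MvPolynomial J k)
    (hgen : Algebra.adjoin S (Set.range x) = ⊤) (hSP : ∀ a ∈ S, a ∈ P → a = 0) : P.FG := by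
  classical
  have hx : Function.Surjective (aeval x : MvPolynomial (Fin m) S →ₐ[S] MvPolynomial J k) := by
    rw [← AlgHom.range_eq_top, ← hgen, Algebra.adjoin_range_eq_range_aeval]
  obtain ⟨G, hGP, hG⟩ := exists_finset_of_surjective hx P
  let V : Finset J := G.biUnion vars
  let r : MvPolynomial (V : Set J) k →ₐ[k] MvPolynomial J k := rename Subtype.val
  let p := P.comap r
  have hle : p.map r ≤ P := Ideal.map_comap_le
  have hp := isPrime_map_rename_subtype (V : Set J) (p := p) (Ideal.IsPrime.comap r)
  have hGp : Ideal.span (G : Set (MvPolynomial J k)) ≤ p.map r := by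
    refine Ideal.span_le.2 fun g hg => ?_
    have : g ∈ supported k (V : Set J) := mem_supported.2 (by
      exact_mod_cast Finset.subset_biUnion_of_mem vars hg)
    rw [supported_eq_range_rename] at this
    obtain ⟨g, rfl⟩ := this
    exact Ideal.mem_map_of_mem r (hGP hg)
  have : P = p.map r := by
    refine le_antisymm (fun f hf => ?_) hle
    obtain ⟨t, ht0, ht⟩ := hG f hf
    exact (hp.mem_or_mem (hGp ht)).resolve_left fun h => ht0 (Subtype.ext (hSP t t.2 (hle h)))
  rw [this]
  exact Ideal.FG.map (IsNoetherian.noetherian p) _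

end

section
variable {k : Type*} [Field k] {Q : Type*} [CommRing Q] [Algebra k Q]

/-- The decomposable elements of degree `e`: the span of the products of elements of smaller
positive degrees. -/
def decomposables (𝒜 : ℕ → Submodule k Q) (e : ℕ) : Submodule k Q :=
  ⨆ p : {p : ℕ × ℕ // 0 < p.1 ∧ 0 < p.2 ∧ p.1 + p.2 = e}, 𝒜 p.1.1 * 𝒜 p.1.2

/-- A grading of an algebra (not necessarily exhausting it), with projections to the graded
pieces and with a family of algebra endomorphisms which are unipotent with respect to the
degree and have no common invariants of positive degree. -/
structure IsUnipotentGrading (𝒜 : ℕ → Submodule k Q) (comp : ℕ → Q →ₗ[k] Q)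
    (T : Set (Q →ₐ[k] Q)) : Prop where
  zero : 𝒜 0 = 1
  mul : ∀ a b, 𝒜 a * 𝒜 b ≤ 𝒜 (a + b)
  comp_self : ∀ e, ∀ a ∈ 𝒜 e, comp e a = a
  comp_ne : ∀ e e', e ≠ e' → ∀ a ∈ 𝒜 e, comp e' a = 0
  trans : ∀ τ ∈ T, ∀ e, ∀ a ∈ 𝒜 e, τ a - a ∈ ⨆ i : Fin e, 𝒜 i
  fixed : ∀ e, 0 < e → ∀ a ∈ 𝒜 e, (∀ τ ∈ T, τ a = a) → a = 0

/-- A system of homogeneous elements which form a basis modulo decomposables in each degree. -/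
structure IsGeneratingSystem {J : Type*} (𝒜 : ℕ → Submodule k Q) (w : J → ℕ) (y : J → Q) :
    Prop where
  pos : ∀ j, 0 < w j
  mem : ∀ j, y j ∈ 𝒜 (w j)
  indep : ∀ e, LinearIndepOn k (fun j => (decomposables 𝒜 e).mkQ (y j)) {j | w j = e}
  span : ∀ e, 0 < e → 𝒜 e ≤ Submodule.span k (y '' {j | w j = e}) ⊔ decomposables 𝒜 e

theorem exists_isGeneratingSystem {Q : Type u} [CommRing Q] [Algebra k Q]
    (𝒜 : ℕ → Submodule k Q) {r : ℕ} (F : Fin r → Q) (δ : Fin r → ℕ) (hδ : ∀ i, 0 < δ i)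
    (hF : ∀ i, F i ∈ 𝒜 (δ i))
    (hli : ∀ e, LinearIndepOn k (fun i => (decomposables 𝒜 e).mkQ (F i)) {i | δ i = e}) :
    ∃ (J : Type u) (w : J → ℕ) (y : J → Q) (ι : Fin r → J), Function.Injective ι ∧
      (∀ i, w (ι i) = δ i) ∧ (∀ i, y (ι i) = F i) ∧ IsGeneratingSystem 𝒜 w y := by
  have h1 : ∀ e, ∃ b ⊆ (𝒜 e : Set Q), F '' {i | δ i = e} ⊆ b ∧
      (decomposables 𝒜 e).mkQ '' (𝒜 e) ⊆ Submodule.span k ((decomposables 𝒜 e).mkQ '' b) ∧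
      LinearIndepOn k (decomposables 𝒜 e).mkQ b := fun e => by
    refine exists_linearIndepOn_extension ?_ ?_
    · exact (hli e).image_of_comp
    · rintro _ ⟨i, rfl, rfl⟩
      exact hF i
  choose b hb1 hb2 hb3 hb4 using h1
  refine ⟨{p : ℕ × Q // 0 < p.1 ∧ p.2 ∈ b p.1}, fun p => p.1.1, fun p => p.1.2,
    fun i => ⟨(δ i, F i), hδ i, hb2 _ ⟨i, rfl, rfl⟩⟩, ?_, fun i => rfl, fun i => rfl, ?_⟩
  · intro i i' h
    have h2 : δ i = δ i' ∧ F i = F i' := by simpa using h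
    exact (hli (δ i')).injOn h2.1 rfl (by simp [h2.2])
  · refine ⟨fun j => j.2.1, fun j => hb1 _ j.2.2, fun e => ?_, fun e he a ha => ?_⟩
    · have h3 : LinearIndepOn k ((decomposables 𝒜 e).mkQ)
          ((fun p : {p : ℕ × Q // 0 < p.1 ∧ p.2 ∈ b p.1} => p.1.2) '' {j | j.1.1 = e}) :=
        (hb4 e).mono (by rintro _ ⟨p, rfl, rfl⟩; exact p.2.2)
      exact h3.comp_of_image (by
        rintro ⟨⟨_, p⟩, hp⟩ rfl ⟨⟨_, q⟩, hq⟩ h5 h6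
        simp only [Set.mem_ofPred_eq] at h5 h6
        subst h5 h6
        rfl)
    · have h3 := hb3 e ⟨a, ha, rfl⟩
      rw [← Submodule.map_span] at h3
      obtain ⟨c, hc, hc'⟩ := h3
      have h4 : a - c ∈ decomposables 𝒜 e := by
        rw [← Submodule.ker_mkQ (decomposables 𝒜 e), LinearMap.mem_ker, map_sub, hc', sub_self]
      rw [show a = c + (a - c) by ring]
      refine Submodule.add_mem_sup (Submodule.span_mono ?_ hc) h4
      intro q hq
      exact ⟨⟨(e, q), he, hq⟩, rfl, rfl⟩

variable {J : Type*} {𝒜 : ℕ → Submodule k Q} {w : J → ℕ} {y : J → Q}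

theorem IsGeneratingSystem.aeval_mem (hy : IsGeneratingSystem 𝒜 w y) {comp} {T}
    (h𝒜 : IsUnipotentGrading 𝒜 comp T) {e : ℕ} {f : MvPolynomial J k}
    (hf : IsWeightedHomogeneous w f e) : aeval y f ∈ 𝒜 e := by
  have hmul : ∀ {a b x y}, x ∈ 𝒜 a → y ∈ 𝒜 b → x * y ∈ 𝒜 (a + b) := fun hx hy =>
    h𝒜.mul _ _ (Submodule.mul_mem_mul hx hy)
  have hone : (1 : Q) ∈ 𝒜 0 := by rw [h𝒜.zero]; exact Submodule.one_le.1 le_rfl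
  rw [aeval_def, eval₂_eq]
  refine Submodule.sum_mem _ fun m hm => ?_
  rw [← Algebra.smul_def]
  refine Submodule.smul_mem _ _ ?_
  rw [← hf (mem_support_iff.1 hm), Finsupp.weight_apply, Finsupp.sum]
  have hpow : ∀ (n : ℕ) (j : J), y j ^ n ∈ 𝒜 (n • w j) := by
    intro n j
    induction n with
    | zero => simpa using hone
    | succ n ih => rw [pow_succ, succ_nsmul]; exact hmul ih (hy.mem j)
  classical
  induction m.support using Finset.induction_on with
  | empty => simpa using hone
  | insert j s hj ih =>
    rw [Finset.prod_insert hj, Finset.sum_insert hj]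
    exact hmul (hpow _ _) ih

theorem IsGeneratingSystem.exists_aeval_eq (hy : IsGeneratingSystem 𝒜 w y) {comp} {T}
    (h𝒜 : IsUnipotentGrading 𝒜 comp T) {e : ℕ} : ∀ a ∈ 𝒜 e,
    ∃ f : MvPolynomial J k, IsWeightedHomogeneous w f e ∧ aeval y f = a := by
  induction e using Nat.strong_induction_on with
  | _ e ih =>
  let H : ℕ → Submodule k Q := fun e =>
    (weightedHomogeneousSubmodule k w e).map (aeval y : MvPolynomial J k →ₐ[k] Q).toLinearMap
  suffices 𝒜 e ≤ H e from fun a ha => this ha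
  rcases Nat.eq_zero_or_pos e with rfl | he
  · rw [h𝒜.zero, Submodule.one_le]
    exact ⟨1, isWeightedHomogeneous_one _ _, by simp⟩
  · refine (hy.span e he).trans (sup_le (Submodule.span_le.2 ?_) (iSup_le ?_))
    · rintro _ ⟨j, rfl, rfl⟩
      exact ⟨X j, isWeightedHomogeneous_X _ _ _, by simp⟩
    · rintro ⟨⟨a, b⟩, ha, hb, hab⟩
      simp only at ha hb hab ⊢
      refine Submodule.mul_le.2 fun x hx z hz => ?_
      obtain ⟨f, hf, rfl⟩ := ih a (by omega) x hx
      obtain ⟨g, hg, rfl⟩ := ih b (by omega) z hz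
      exact ⟨f * g, hab ▸ hf.mul hg, by simp⟩

theorem IsGeneratingSystem.exists_aeval_eq_of_mem_iSup (hy : IsGeneratingSystem 𝒜 w y) {comp} {T}
    (h𝒜 : IsUnipotentGrading 𝒜 comp T) {e : ℕ} {a : Q} (ha : a ∈ ⨆ i : Fin e, 𝒜 i) :
    ∃ f ∈ (weightLT w e : Submodule k (MvPolynomial J k)), aeval y f = a := by
  suffices ⨆ i : Fin e, 𝒜 i ≤
    (weightLT w e).map (aeval y : MvPolynomial J k →ₐ[k] Q).toLinearMap from this ha
  refine iSup_le fun i x hx => ?_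
  obtain ⟨f, hf, rfl⟩ := hy.exists_aeval_eq h𝒜 x hx
  exact ⟨f, weightLT_mono i.2 hf.mem_weightLT, rfl⟩

theorem pderiv_aeval_eq {g : J → MvPolynomial J k} {f : MvPolynomial J k} (j : J)
    (h : ∀ i, pderiv i f ≠ 0 → pderiv j (g i) = pderiv j (X i)) :
    pderiv j (aeval g f) = aeval g (pderiv j f) := by
  classical
  have key : ∀ f : MvPolynomial J k, pderiv j (aeval g f) =
      ∑ i ∈ f.vars, aeval g (pderiv i f) * pderiv j (g i) := by
    intro f
    suffices ∀ (s : Finset J) (f : MvPolynomial J k), f ∈ supported k (s : Set J) →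
        pderiv j (aeval g f) = ∑ i ∈ s, aeval g (pderiv i f) * pderiv j (g i) from
      this _ f (mem_supported.2 subset_rfl)
    intro s f hf
    induction hf using Algebra.adjoin_induction with
    | mem x hx =>
      obtain ⟨i, hi, rfl⟩ := hx
      rw [aeval_X, Finset.sum_eq_single i]
      · simp
      · intro b _ hb
        rw [pderiv_X_of_ne hb.symm, map_zero, zero_mul]
      · intro h; exact absurd hi h
    | algebraMap c => simp [algebraMap_eq]
    | add x y _ _ hx hy => simp only [map_add, hx, hy, add_mul, Finset.sum_add_distrib]
    | mul x y _ _ hx hy =>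
      rw [map_mul, Derivation.leibniz, hx, hy, smul_eq_mul, smul_eq_mul, Finset.mul_sum,
        Finset.mul_sum, ← Finset.sum_add_distrib]
      refine Finset.sum_congr rfl fun i _ => ?_
      rw [Derivation.leibniz, smul_eq_mul, smul_eq_mul, map_add, map_mul, map_mul]
      ring
  rw [key]
  by_cases hj : j ∈ f.vars
  · rw [Finset.sum_eq_single_of_mem j hj]
    · by_cases hf : pderiv j f = 0
      · simp [hf]
      · rw [h j hf, pderiv_X_self, mul_one]
    · intro b _ hb
      by_cases hf : pderiv b f = 0
      · simp [hf]
      · rw [h b hf, pderiv_X_of_ne hb, mul_zero]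
  · rw [Finset.sum_eq_zero, pderiv_eq_zero_of_notMem_vars hj, map_zero]
    intro i hi
    by_cases hf : pderiv i f = 0
    · simp [hf]
    · rw [h i hf, pderiv_X_of_ne (by rintro rfl; exact hj hi), mul_zero]

theorem dvd_of_pderiv_eq_zero (p : ℕ) [CharP k p] {f : MvPolynomial J k}
    (h : ∀ j, pderiv j f = 0) {m : J →₀ ℕ} (hm : coeff m f ≠ 0) (j : J) : p ∣ m j := by
  classical
  by_cases hmj : m j = 0
  · simp [hmj]
  have h1 := congrArg (coeff (m - Finsupp.single j 1)) (h j)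
  have h2 : m - Finsupp.single j 1 + Finsupp.single j 1 = m := by
    refine tsub_add_cancel_of_le ?_
    rw [Finsupp.single_le_iff]; omega
  rw [coeff_pderiv, h2, coeff_zero, mul_eq_zero] at h1
  have h3 := h1.resolve_left hm
  rw [← CharP.cast_eq_zero_iff k p, ← h3]
  have h4 : m j = (m - Finsupp.single j 1 : J →₀ ℕ) j + 1 := by
    simpa using (DFunLike.congr_fun h2 j).symm
  rw [h4, Nat.cast_add, Nat.cast_one]

theorem exists_pow_char_eq [IsAlgClosed k] (p : ℕ) [Fact p.Prime] [CharP k p]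
    {f : MvPolynomial J k} (h : ∀ j, pderiv j f = 0) :
    ∃ g : MvPolynomial J k, g ^ p = f ∧ ∀ m, coeff m g ≠ 0 → coeff (p • m) f ≠ 0 := by
  classical
  have hprime : p.Prime := Fact.out
  have hdiv : ∀ m ∈ f.support, p • m.mapRange (· / p) (by simp) = m := by
    intro m hm
    ext j
    simp [Nat.mul_div_cancel' (dvd_of_pderiv_eq_zero p h (mem_support_iff.1 hm) j)]
  have hroot : ∀ c : k, ∃ b, b ^ p = c := fun c => IsAlgClosed.exists_pow_nat_eq c hprime.pos
  choose root hroot using hroot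
  refine ⟨∑ m ∈ f.support, monomial (m.mapRange (· / p) (by simp)) (root (coeff m f)), ?_, ?_⟩
  · rw [sum_pow_char]
    conv_rhs => rw [f.as_sum]
    refine Finset.sum_congr rfl fun m hm => ?_
    rw [monomial_pow, hroot, hdiv m hm]
  · intro m hm
    rw [coeff_sum] at hm
    obtain ⟨m', hm', h'⟩ := Finset.exists_ne_zero_of_sum_ne_zero hm
    rw [coeff_monomial] at h'
    have h5 : m'.mapRange (· / p) (by simp) = m := by
      by_contra h6
      exact h' (if_neg h6)
    rw [← h5, hdiv m' hm']
    exact mem_support_iff.1 hm'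

/-- A weighted homogeneous polynomial of positive weight with vanishing partial derivatives is a
power of a polynomial of smaller weight. -/
theorem exists_pow_eq_of_pderiv_eq_zero [IsAlgClosed k] {e : ℕ} (he : 0 < e)
    {f : MvPolynomial J k} (hf : IsWeightedHomogeneous w f e) (hf0 : f ≠ 0)
    (h : ∀ j, pderiv j f = 0) :
    ∃ (p : ℕ) (g : MvPolynomial J k) (e' : ℕ), e' < e ∧ IsWeightedHomogeneous w g e' ∧
      g ^ p = f := by
  obtain ⟨p, hp⟩ := CharP.exists k
  have hp0 : p ≠ 0 := by
    rintro rfl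
    obtain ⟨m, hm⟩ := ne_zero_iff.1 hf0
    have h1 : m = 0 := by
      ext j
      exact zero_dvd_iff.1 (dvd_of_pderiv_eq_zero 0 h hm j)
    have h2 := hf hm
    rw [h1, map_zero] at h2
    omega
  have hprime : p.Prime := (CharP.char_is_prime_or_zero k p).resolve_right hp0
  have : Fact p.Prime := ⟨hprime⟩
  obtain ⟨g, hg, hgf⟩ := exists_pow_char_eq p h
  refine ⟨p, g, e / p, Nat.div_lt_self he hprime.one_lt, fun m hm => ?_, hg⟩
  rw [← hf (hgf m hm), map_nsmul, smul_eq_mul, Nat.mul_div_cancel_left _ hprime.pos]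

end

section
variable {k : Type*} [Field k] {Q : Type*} [CommRing Q] [Algebra k Q]
variable {J : Type*} {𝒜 : ℕ → Submodule k Q} {w : J → ℕ} {y : J → Q}

theorem IsGeneratingSystem.eq_zero_of_weight_eq_zero (hy : IsGeneratingSystem 𝒜 w y)
    {m : J →₀ ℕ} (hm : Finsupp.weight w m = 0) : m = 0 :=
  have := Finsupp.nonTorsionWeight_of (R := ℕ) (w := w) (hw := fun i => (hy.pos i).ne')
  (Finsupp.weight_eq_zero_iff_eq_zero w).1 hm

theorem IsGeneratingSystem.mem_decomposables (hy : IsGeneratingSystem 𝒜 w y) {comp} {T}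
    (h𝒜 : IsUnipotentGrading 𝒜 comp T) {m : J →₀ ℕ} (hm0 : m ≠ 0)
    (hm : ∀ j, m ≠ Finsupp.single j 1) :
    aeval y (monomial m (1 : k)) ∈ decomposables 𝒜 (Finsupp.weight w m) := by
  classical
  have hex : ∃ j, m j ≠ 0 := by
    by_contra! hh
    exact hm0 (Finsupp.ext hh)
  obtain ⟨j, hj⟩ := hex
  have h2 : m - Finsupp.single j 1 + Finsupp.single j 1 = m := by
    refine tsub_add_cancel_of_le ?_
    rw [Finsupp.single_le_iff]; omega
  have h3 : m - Finsupp.single j 1 ≠ 0 := fun h => hm j (by rw [← h2, h, zero_add])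
  have h4 : 0 < Finsupp.weight w (m - Finsupp.single j 1) := by
    rw [Nat.pos_iff_ne_zero]
    intro h
    apply h3
    exact hy.eq_zero_of_weight_eq_zero h
  have h5 : Finsupp.weight w m = Finsupp.weight w (m - Finsupp.single j 1) + w j := by
    rw [← weight_le_of_single_add, h2]
  have h6 : (monomial m (1 : k)) = monomial (m - Finsupp.single j 1) 1 * X j := by
    rw [X, monomial_mul, h2, one_mul]
  rw [h6, map_mul, aeval_X]
  refine Submodule.mem_iSup_of_mem ⟨(_, w j), h4, hy.pos j, h5.symm⟩ ?_
  exact Submodule.mul_mem_mul (hy.aeval_mem h𝒜 (isWeightedHomogeneous_monomial _ _ _ rfl))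
    (hy.mem j)

/-- A weighted homogeneous polynomial vanishing on a generating system has no linear terms. -/
theorem IsGeneratingSystem.coeff_single_eq_zero (hy : IsGeneratingSystem 𝒜 w y) {comp} {T}
    (h𝒜 : IsUnipotentGrading 𝒜 comp T) {e : ℕ} (he : 0 < e) {f : MvPolynomial J k}
    (hf : IsWeightedHomogeneous w f e) (hf0 : aeval y f = 0) (j : J) :
    coeff (Finsupp.single j 1) f = 0 := by
  classical
  by_contra hj
  have hwj : w j = e := by
    have := hf hj
    rwa [Finsupp.weight_single, one_smul] at this
  have h1 := hy.indep e
  rw [linearIndepOn_iff'] at h1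
  let s := f.support.filter (fun m => ∃ j, m = Finsupp.single j 1)
  let t : Finset J := f.vars.filter (fun j => w j = e)
  refine hj (h1 t (fun i => coeff (Finsupp.single i 1) f) (fun i hi => (Finset.mem_filter.1 hi).2)
    ?_ j (Finset.mem_filter.2 ⟨?_, hwj⟩))
  swap
  · rw [mem_vars_iff_mem_support]
    exact ⟨_, mem_support_iff.2 hj, by simp⟩
  have h2 : f = ∑ i ∈ t, coeff (Finsupp.single i 1) f • X i + ∑ m ∈ f.support \ s,
      coeff m f • monomial m 1 := by
    conv_lhs => rw [f.as_sum, ← Finset.sum_sdiff (Finset.filter_subset _ _ : s ⊆ f.support), add_comm]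
    congr 1
    · symm
      refine Finset.sum_bij_ne_zero (fun i _ _ => Finsupp.single i 1) ?_ ?_ ?_ ?_
      · intro i hi h
        refine Finset.mem_filter.2 ⟨mem_support_iff.2 fun h' => h ?_, i, rfl⟩
        rw [h', zero_smul]
      · intro i _ _ i' _ _ h
        exact Finsupp.single_left_injective one_ne_zero h
      · intro m hm _
        obtain ⟨hm, i, rfl⟩ := Finset.mem_filter.1 hm
        rw [mem_support_iff] at hm
        refine ⟨i, Finset.mem_filter.2 ⟨mem_vars_iff_mem_support _ |>.2 ⟨_, mem_support_iff.2 hm, by simp⟩, ?_⟩, ?_, rfl⟩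
        · have := hf hm
          rwa [Finsupp.weight_single, one_smul] at this
        · intro h
          rw [smul_eq_zero] at h
          exact h.elim hm (X_ne_zero i)
      · intro i _ _
        rw [X, smul_monomial, smul_eq_mul, mul_one]
    · refine Finset.sum_congr rfl fun m _ => ?_
      rw [smul_monomial, smul_eq_mul, mul_one]
  have h3 := congrArg (fun g => (decomposables 𝒜 e).mkQ (aeval y g)) h2
  simp only [hf0, map_zero, map_add, map_sum, map_smul, aeval_X] at h3
  rw [eq_comm, Finset.sum_eq_zero (s := f.support \ s), add_zero] at h3
  · exact h3
  · intro m hm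
    rw [Finset.mem_sdiff, mem_support_iff] at hm
    obtain ⟨hm1, hm2⟩ := hm
    have h4 : (decomposables 𝒜 e).mkQ (aeval y (monomial m (1 : k))) = 0 := by
      rw [← LinearMap.mem_ker, Submodule.ker_mkQ, ← hf hm1]
      refine hy.mem_decomposables h𝒜 ?_ fun j h => hm2 (Finset.mem_filter.2
        ⟨mem_support_iff.2 hm1, j, h⟩)
      rintro rfl
      have := hf hm1
      rw [map_zero] at this
      omega
    rw [h4, smul_zero]

theorem IsGeneratingSystem.eq_zero_of_aeval_eq_zero [IsAlgClosed k] [IsDomain Q]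
    (hy : IsGeneratingSystem 𝒜 w y) {comp} {T}
    (h𝒜 : IsUnipotentGrading 𝒜 comp T) {f : MvPolynomial J k} (hf : aeval y f = 0) : f = 0 := by
  classical
  have hcomp : ∀ (f : MvPolynomial J k), aeval y f = 0 → ∀ e,
      aeval y (weightedHomogeneousComponent w e f) = 0 := by
    intro f hf e
    have h1 := congrArg (comp e) hf
    rw [map_zero] at h1
    rw [← h1]
    conv_rhs => rw [← sum_weightedHomogeneousComponent w f, finsum_eq_sum _
      (weightedHomogeneousComponent_finsupp f), map_sum, map_sum]
    rw [Finset.sum_eq_single e]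
    · exact (h𝒜.comp_self e _ (hy.aeval_mem h𝒜
        (weightedHomogeneousComponent_isWeightedHomogeneous _ _))).symm
    · intro b _ hb
      exact h𝒜.comp_ne _ _ hb _ (hy.aeval_mem h𝒜
        (weightedHomogeneousComponent_isWeightedHomogeneous _ _))
    · intro he
      replace he := fun h => he ((Set.Finite.mem_toFinset _).2 (Function.mem_support.2 h))
      rw [not_not.1 he, map_zero, map_zero]
  suffices h : ∀ e, ∀ f : MvPolynomial J k, IsWeightedHomogeneous w f e → aeval y f = 0 → f = 0 by
    rw [← sum_weightedHomogeneousComponent w f]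
    exact finsum_eq_zero_of_forall_eq_zero fun e => h e _
      (weightedHomogeneousComponent_isWeightedHomogeneous _ _) (hcomp f hf e)
  clear hf f
  intro e
  induction e using Nat.strong_induction_on with
  | _ e ih =>
  intro f hf hf0
  have ih' : ∀ g ∈ (weightLT w e : Submodule k (MvPolynomial J k)), aeval y g = 0 → g = 0 := by
    intro g hg hg0
    rw [← sum_weightedHomogeneousComponent w g]
    refine finsum_eq_zero_of_forall_eq_zero fun e' => ?_
    by_cases he' : e' < e
    · exact ih e' he' _ (weightedHomogeneousComponent_isWeightedHomogeneous _ _) (hcomp g hg0 e')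
    · refine weightedHomogeneousComponent_eq_zero' _ _ fun m hm => ?_
      have := mem_weightLT.1 hg m (mem_support_iff.1 hm)
      omega
  by_contra hne
  rcases Nat.eq_zero_or_pos e with rfl | he
  · have : f = C (coeff 0 f) := by
      ext m
      rw [coeff_C]
      split_ifs with h
      · rw [h]
      · by_contra hm
        apply h
        exact (hy.eq_zero_of_weight_eq_zero
          (hf hm)).symm
    rw [this, aeval_C, map_eq_zero] at hf0
    rw [hf0, C_0] at this
    exact hne this
  by_cases hall : ∀ j, pderiv j f = 0
  · obtain ⟨p, g, e', he', hg, rfl⟩ := exists_pow_eq_of_pderiv_eq_zero he hf hne hall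
    rw [map_pow] at hf0
    have hp : p ≠ 0 := by rintro rfl; simp at hf0
    rw [ih e' he' g hg (pow_eq_zero_iff hp |>.1 hf0), zero_pow hp] at hne
    exact hne rfl
  · push Not at hall
    have hfin : {j | pderiv j f ≠ 0}.Finite := f.vars.finite_toSet.subset fun j hj => by
      by_contra h
      exact hj (pderiv_eq_zero_of_notMem_vars h)
    obtain ⟨j, hj, hmax⟩ := hfin.exists_maximalFor w _ hall
    have hmax' : ∀ i, pderiv i f ≠ 0 → w i ≤ w j := fun i hi => by
      by_contra! h
      exact absurd (hmax hi h.le) (by simpa using h)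
    apply hj
    by_cases hwe : e ≤ w j
    · ext m
      rw [coeff_pderiv, coeff_zero]
      by_cases hm : coeff (m + Finsupp.single j 1) f = 0
      · rw [hm, zero_mul]
      have h1 := hf hm
      rw [weight_le_of_single_add] at h1
      have h2 : m = 0 := hy.eq_zero_of_weight_eq_zero
        (by omega)
      rw [h2, zero_add, hy.coeff_single_eq_zero h𝒜 he hf hf0, zero_mul]
    · push Not at hwe
      have hpos := hy.pos j
      have hh : IsWeightedHomogeneous w (pderiv j f) (e - w j) := hf.pderiv (by omega)
      refine ih _ (by omega) _ hh ?_
      refine h𝒜.fixed (e - w j) (by omega) _ (hy.aeval_mem h𝒜 hh) fun τ hτ => ?_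
      have h3 : ∀ i, ∃ d ∈ (weightLT w (w i) : Submodule k (MvPolynomial J k)),
          aeval y d = τ (y i) - y i := fun i =>
        hy.exists_aeval_eq_of_mem_iSup h𝒜 (h𝒜.trans τ hτ _ _ (hy.mem i))
      choose d hd hd' using h3
      have hτ' : ∀ g : MvPolynomial J k, τ (aeval y g) = aeval y (aeval (fun i => X i + d i) g) := by
        intro g
        have : (τ.comp (aeval y) : MvPolynomial J k →ₐ[k] Q) =
            (aeval y).comp (aeval (fun i => X i + d i)) := by
          ext i
          simp [hd']
        exact DFunLike.congr_fun this g
      have hX : ∀ i, (X i : MvPolynomial J k) ∈ weightLT w (w i + 1) := X_mem_weightLT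
      have h4 := (aeval_mem_weightLT_and_sub_mem (R := k) (w := w) (w' := w) (n := e)
        (g := fun i => X i + d i) (g' := X)
        (fun i _ => Submodule.add_mem _ (hX i) (weightLT_mono (Nat.le_succ _) (hd i)))
        (fun i _ => hX i) (fun i _ => by simpa using hd i) hf.mem_weightLT).2
      rw [aeval_X_left_apply] at h4
      have h5 := ih' _ h4 (by rw [map_sub, ← hτ', hf0, map_zero, sub_zero])
      rw [hτ', ← pderiv_aeval_eq, sub_eq_zero.1 h5]
      intro i hi
      rw [map_add]
      convert add_zero _
      ext m
      rw [coeff_pderiv, coeff_zero]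
      by_cases hm : coeff (m + Finsupp.single j 1) (d i) = 0
      · rw [hm, zero_mul]
      have h6 := mem_weightLT.1 (hd i) _ hm
      rw [weight_le_of_single_add] at h6
      have := hmax' i hi
      omega

end

section
open Filter

/-- The ideal of a product of rings consisting of the families that vanish almost everywhere with
respect to an ultrafilter. -/
def nullIdeal (𝒰 : Ultrafilter ℕ) (A : ℕ → Type u) [∀ i, CommRing (A i)] : Ideal (∀ i, A i) where
  carrier := {f | ∀ᶠ i in 𝒰, f i = 0}
  zero_mem' := Eventually.of_forall fun _ => rfl
  add_mem' := fun ha hb => by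
    filter_upwards [ha, hb] with i h1 h2
    rw [Pi.add_apply, h1, h2, add_zero]
  smul_mem' := fun c f hf => by
    filter_upwards [hf] with i h
    rw [smul_eq_mul, Pi.mul_apply, h, mul_zero]

/-- The ultraproduct of a sequence of rings. -/
def Ultraprod (𝒰 : Ultrafilter ℕ) (A : ℕ → Type u) [∀ i, CommRing (A i)] : Type u :=
  (∀ i, A i) ⧸ nullIdeal 𝒰 A

namespace Ultraprod

/-- The ring structure of an ultraproduct. -/
def commRing (𝒰 : Ultrafilter ℕ) (A : ℕ → Type u) [∀ i, CommRing (A i)] :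
    CommRing (Ultraprod 𝒰 A) :=
  Ideal.Quotient.commRing _

instance {𝒰 : Ultrafilter ℕ} {A : ℕ → Type u} [∀ i, CommRing (A i)] : CommRing (Ultraprod 𝒰 A) :=
  commRing 𝒰 A

variable {𝒰 : Ultrafilter ℕ} {A : ℕ → Type u} [∀ i, CommRing (A i)]

variable (𝒰) in
/-- The class of a family of elements in the ultraproduct. -/
def mk : (∀ i, A i) →+* Ultraprod 𝒰 A := Ideal.Quotient.mk _

theorem mk_surjective : Function.Surjective (mk 𝒰 (A := A)) := Ideal.Quotient.mk_surjective

theorem mk_eq_mk {f g : ∀ i, A i} : mk 𝒰 f = mk 𝒰 g ↔ ∀ᶠ i in 𝒰, f i = g i := by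
  refine (Ideal.Quotient.eq (I := nullIdeal 𝒰 A)).trans ?_
  exact eventually_congr (Eventually.of_forall fun i => sub_eq_zero)

theorem mk_eq_zero {f : ∀ i, A i} : mk 𝒰 f = 0 ↔ ∀ᶠ i in 𝒰, f i = 0 := by
  rw [← map_zero (mk 𝒰 (A := A)), mk_eq_mk]
  rfl

theorem mk_congr {f g : ∀ i, A i} (h : ∀ᶠ i in 𝒰, f i = g i) : mk 𝒰 f = mk 𝒰 g :=
  mk_eq_mk.2 h

instance [∀ i, IsDomain (A i)] : IsDomain (Ultraprod 𝒰 A) := by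
  refine (Ideal.Quotient.isDomain_iff_prime (nullIdeal 𝒰 A)).2 ⟨fun h => ?_, fun {f g} h => ?_⟩
  · have h1 : (1 : ∀ i, A i) ∈ nullIdeal 𝒰 A := h ▸ Submodule.mem_top
    obtain ⟨i, hi⟩ := Eventually.exists (show ∀ᶠ i in (𝒰 : Filter ℕ), (1 : ∀ i, A i) i = 0 from h1)
    exact one_ne_zero hi
  · refine Ultrafilter.eventually_or.1 ?_
    refine Eventually.mono h fun i hi => ?_
    exact mul_eq_zero.1 hi

theorem isField {K : ℕ → Type u} [∀ i, Field (K i)] : IsField (Ultraprod 𝒰 K) := by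
  refine ⟨⟨0, 1, zero_ne_one⟩, mul_comm, fun {a} ha => ?_⟩
  obtain ⟨f, rfl⟩ := mk_surjective a
  refine ⟨mk 𝒰 fun i => (f i)⁻¹, ?_⟩
  rw [← map_mul, ← map_one (mk 𝒰), mk_eq_mk]
  have h : ∀ᶠ i in 𝒰, f i ≠ 0 := by
    rw [Ultrafilter.eventually_not]
    exact fun h => ha (mk_eq_zero.2 h)
  filter_upwards [h] with i hi
  exact mul_inv_cancel₀ hi

noncomputable instance {K : ℕ → Type u} [∀ i, Field (K i)] : Field (Ultraprod 𝒰 K) :=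
  Field.ofIsUnitOrEqZero fun _ => or_iff_not_imp_right.2 fun ha =>
    have ⟨b, hb⟩ := isField.mul_inv_cancel ha
    IsUnit.of_mul_eq_one b hb

theorem mk_sum {n : Type*} (s : Finset n) (f : n → ∀ i, A i) :
    ∑ j ∈ s, mk 𝒰 (f j) = mk 𝒰 fun i => ∑ j ∈ s, f j i := by
  rw [← map_sum]
  congr 1
  ext i
  simp

instance {K : ℕ → Type u} [∀ i, Field (K i)] [∀ i, IsAlgClosed (K i)] :
    IsAlgClosed (Ultraprod 𝒰 K) := by
  refine IsAlgClosed.of_exists_root _ fun p hp hirr => ?_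
  have hn : 0 < p.natDegree := hirr.natDegree_pos
  choose c hc using fun j => mk_surjective (𝒰 := 𝒰) (p.coeff j)
  have h1 : ∀ i, ∃ x : K i, x ^ p.natDegree + ∑ j ∈ Finset.range p.natDegree, c j i * x ^ j = 0 := by
    intro i
    let q : Polynomial (K i) := Polynomial.X ^ p.natDegree +
      ∑ j ∈ Finset.range p.natDegree, Polynomial.C (c j i) * Polynomial.X ^ j
    have hq : q.degree = p.natDegree := by
      refine (Polynomial.degree_add_eq_left_of_degree_lt ?_).trans (Polynomial.degree_X_pow _)
      rw [Polynomial.degree_X_pow]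
      refine (Polynomial.degree_sum_le _ _).trans_lt ?_
      rw [Finset.sup_lt_iff (WithBot.bot_lt_coe _)]
      intro j hj
      exact (Polynomial.degree_C_mul_X_pow_le _ _).trans_lt (by exact_mod_cast Finset.mem_range.1 hj)
    obtain ⟨x, hx⟩ := IsAlgClosed.exists_root q (by rw [hq]; exact_mod_cast hn.ne')
    refine ⟨x, ?_⟩
    simpa [q, Polynomial.IsRoot, Polynomial.eval_finsetSum] using hx
  choose x hx using h1
  refine ⟨mk 𝒰 x, ?_⟩
  rw [Polynomial.eval_eq_sum_range, Finset.sum_range_succ, hp.coeff_natDegree, one_mul, add_comm]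
  simp_rw [← hc, ← map_pow, ← map_mul]
  rw [mk_sum, ← map_add, mk_eq_zero]
  exact Eventually.of_forall hx

section Algebra

variable {K : ℕ → Type u} [∀ i, Field (K i)] [∀ i, Algebra (K i) (A i)]

/-- The structure map of an ultraproduct of algebras. -/
noncomputable def structureMap : Ultraprod 𝒰 K →+* Ultraprod 𝒰 A :=
  Ideal.quotientMap (I := nullIdeal 𝒰 K) (nullIdeal 𝒰 A)
    (RingHom.pi fun i => (algebraMap (K i) (A i)).comp (Pi.evalRingHom K i)) (fun f hf => by
      refine Eventually.mono hf fun i hi => ?_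
      change algebraMap _ _ (f i) = 0
      rw [hi, map_zero])

noncomputable instance : Algebra (Ultraprod 𝒰 K) (Ultraprod 𝒰 A) :=
  structureMap.toAlgebra

theorem algebraMap_mk (c : ∀ i, K i) : algebraMap (Ultraprod 𝒰 K) (Ultraprod 𝒰 A) (mk 𝒰 c) =
    mk 𝒰 fun i => algebraMap (K i) (A i) (c i) := rfl

theorem mk_smul_mk (c : ∀ i, K i) (f : ∀ i, A i) : mk 𝒰 c • mk 𝒰 f = mk 𝒰 fun i => c i • f i := by
  rw [Algebra.smul_def, algebraMap_mk, ← map_mul]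
  congr 1
  ext i
  simp [Algebra.smul_def]

end Algebra

/-- The class of a family of maps. -/
noncomputable def map (f : ∀ i, A i → A i) : Ultraprod 𝒰 A → Ultraprod 𝒰 A :=
  fun q => mk 𝒰 fun i => f i (Function.surjInv (mk_surjective (𝒰 := 𝒰)) q i)

theorem map_mk (f : ∀ i, A i → A i) (a : ∀ i, A i) :
    map f (mk 𝒰 a) = mk 𝒰 fun i => f i (a i) := by
  refine mk_congr ?_
  filter_upwards [mk_eq_mk.1 (Function.surjInv_eq (mk_surjective (𝒰 := 𝒰)) (mk 𝒰 a))] with i hi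
  rw [hi]

variable (𝒰) in
/-- The classes of families of elements of a given family of sets. -/
def internal (s : ∀ i, Set (A i)) : Set (Ultraprod 𝒰 A) :=
  {q | ∃ f, mk 𝒰 f = q ∧ ∀ᶠ i in 𝒰, f i ∈ s i}

theorem mk_mem_internal {s : ∀ i, Set (A i)} {f : ∀ i, A i} :
    mk 𝒰 f ∈ internal 𝒰 s ↔ ∀ᶠ i in 𝒰, f i ∈ s i := by
  refine ⟨?_, fun h => ⟨f, rfl, h⟩⟩
  rintro ⟨g, hg, h⟩
  filter_upwards [h, mk_eq_mk.1 hg] with i h1 h2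
  rwa [← h2]

end Ultraprod

end

section
variable {K σ : Type*} [Field K]

theorem sum_homogeneousComponent_of_mem_weightLT {e : ℕ} {f : MvPolynomial σ K}
    (hf : f ∈ weightLT (1 : σ → ℕ) e) : ∑ j ∈ Finset.range e, homogeneousComponent j f = f := by
  classical
  ext m
  rw [coeff_sum]
  simp_rw [coeff_homogeneousComponent]
  by_cases hm : coeff m f = 0
  · simp [hm]
  · have h1 := mem_weightLT.1 hf m hm
    rw [show Finsupp.weight (1 : σ → ℕ) m = m.degree from
      (DFunLike.congr_fun Finsupp.degree_eq_weight_one m).symm] at h1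
    rw [Finset.sum_ite_eq, if_pos (Finset.mem_range.2 h1)]

theorem translate_sub_mem_weightLT {e : ℕ} {f : MvPolynomial σ K} (hf : f.IsHomogeneous e)
    (c : σ → K) : aeval (fun j => X j + C (c j)) f - f ∈ weightLT (1 : σ → ℕ) e := by
  have hX : ∀ i, (X i : MvPolynomial σ K) ∈ weightLT (1 : σ → ℕ) ((1 : σ → ℕ) i + 1) :=
    X_mem_weightLT
  have h := (aeval_mem_weightLT_and_sub_mem (R := K) (w := (1 : σ → ℕ)) (w' := 1) (n := e)
    (g := fun i => X i + C (c i)) (g' := X)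
    (fun i _ => Submodule.add_mem _ (hX i) (C_mem_weightLT (Nat.succ_pos _) _))
    (fun i _ => hX i)
    (fun i _ => by simpa using C_mem_weightLT one_pos (c i))
    (IsWeightedHomogeneous.mem_weightLT hf)).2
  rwa [aeval_X_left_apply] at h

theorem exists_translate_ne [Infinite K] {e : ℕ} (he : 0 < e) {f : MvPolynomial σ K}
    (hf : f.IsHomogeneous e) (hf0 : f ≠ 0) : ∃ c : σ → K, aeval (fun j => X j + C (c j)) f ≠ f := by
  by_contra! h
  apply hf0
  refine MvPolynomial.funext fun c => ?_
  have h1 := congrArg (aeval (fun _ => (0 : K))) (h c)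
  rw [← AlgHom.comp_apply, comp_aeval] at h1
  simp only [map_add, aeval_X, zero_add, aeval_C] at h1
  rw [map_zero, ← coe_aeval_eq_eval]
  refine Eq.trans ?_ (h1.trans ?_)
  · rfl
  · change aeval (0 : σ → K) f = 0
    rw [aeval_zero, map_eq_zero]
    by_contra h0
    have h2 := hf h0
    rw [map_zero] at h2
    omega

theorem exists_homogeneous_coeffs {J : Type*} {V : Finset J} {w : J → ℕ} {Y : J → MvPolynomial σ K}
    (hY : ∀ j ∈ V, (Y j).IsHomogeneous (w j)) {e : ℕ} {f : MvPolynomial σ K}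
    (hf : f.IsHomogeneous e) (hfY : f ∈ Ideal.span (Y '' V)) :
    ∃ c : J → MvPolynomial σ K, (∀ j, (c j).IsHomogeneous (e - w j)) ∧ f = ∑ j ∈ V, c j * Y j := by
  classical
  let _ : GradedAlgebra (homogeneousSubmodule σ K) := gradedAlgebra
  obtain ⟨c, rfl⟩ := (Submodule.mem_span_image_finset_iff_exists_fun' (MvPolynomial σ K)).1 hfY
  refine ⟨fun j => if w j ≤ e then DirectSum.decompose (homogeneousSubmodule σ K) (c j) (e - w j) else 0, fun j => ?_, ?_⟩
  · dsimp only
    split_ifs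
    · exact (DirectSum.decompose (homogeneousSubmodule σ K) (c j) (e - w j)).2
    · exact isHomogeneous_zero _ _ _
  · have h1 := DirectSum.decompose_of_mem_same (homogeneousSubmodule σ K) hf
    rw [← h1, DirectSum.decompose_sum, DFinsupp.finsetSum_apply, AddSubmonoidClass.coe_finsetSum]
    refine Finset.sum_congr rfl fun j hj => ?_
    rw [smul_eq_mul, DirectSum.coe_decompose_mul_of_right_mem (homogeneousSubmodule σ K) e (hY j hj)]
    dsimp only
    split_ifs
    · rfl
    · rw [zero_mul]

theorem exists_pow_char_eq_of_mem_supported [IsAlgClosed K] (p : ℕ) [Fact p.Prime] [CharP K p]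
    {s : Set σ} {f : MvPolynomial σ K} (hfs : f ∈ supported K s) (hf : ∀ j, pderiv j f = 0) :
    ∃ g ∈ supported K s, g ^ p = f := by
  obtain ⟨g, hg, hgf⟩ := exists_pow_char_eq p hf
  refine ⟨g, mem_supported.2 fun j hj => ?_, hg⟩
  obtain ⟨m, hm, hmj⟩ := (mem_vars_iff_mem_support j).1 hj
  refine mem_supported.1 hfs ((mem_vars_iff_mem_support j).2
    ⟨p • m, mem_support_iff.2 (hgf m (mem_support_iff.1 hm)), ?_⟩)
  rw [Finsupp.mem_support_iff] at hmj ⊢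
  simpa [(Fact.out : p.Prime).ne_zero] using hmj

theorem pderiv_mem_supported {s : Set σ} {f : MvPolynomial σ K} (hf : f ∈ supported K s) (j : σ) :
    pderiv j f ∈ supported K s := by
  classical
  induction hf using Algebra.adjoin_induction with
  | mem x hx =>
    obtain ⟨i, hi, rfl⟩ := hx
    rw [pderiv_X]
    by_cases h : i = j
    · rw [h, Pi.single_eq_same]; exact one_mem _
    · rw [Pi.single_eq_of_ne h]; exact zero_mem _
  | algebraMap c => rw [Derivation.map_algebraMap]; exact zero_mem _
  | add x y _ _ hx hy => rw [map_add]; exact add_mem hx hy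
  | mul x y hx' hy' hx hy =>
    rw [Derivation.leibniz]
    exact add_mem (mul_mem hx' hy) (mul_mem hy' hx)

theorem killVars_mem_supported (s : Set σ) (f : MvPolynomial σ K) :
    killVars K s f ∈ supported K sᶜ := by
  classical
  suffices (killVars K s).range ≤ supported K sᶜ from this ⟨f, rfl⟩
  rw [killVars, ← Algebra.adjoin_range_eq_range_aeval]
  refine Algebra.adjoin_le ?_
  rintro _ ⟨j, rfl⟩
  dsimp only
  split_ifs with h
  · exact zero_mem _
  · exact Algebra.subset_adjoin ⟨j, h, rfl⟩

theorem killVars_eq_self {s : Set σ} {f : MvPolynomial σ K} (hf : f ∈ supported K sᶜ) :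
    killVars K s f = f := by
  induction hf using Algebra.adjoin_induction with
  | mem x hx =>
    obtain ⟨i, hi, rfl⟩ := hx
    rw [killVars, aeval_X, if_neg hi]
  | algebraMap c => exact AlgHom.commutes _ c
  | add x y _ _ hx hy => rw [map_add, hx, hy]
  | mul x y _ _ hx hy => rw [map_mul, hx, hy]

theorem exists_eq_add_sum_mul_X {e : ℕ} {f : MvPolynomial σ K} (hf : f.IsHomogeneous (e + 1))
    {m : ℕ} (κ : Fin m → σ) :
    ∃ (h : MvPolynomial σ K) (c : Fin m → MvPolynomial σ K), h ∈ supported K (Set.range κ)ᶜ ∧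
      h.IsHomogeneous (e + 1) ∧ (∀ l, (c l).IsHomogeneous e) ∧ f = h + ∑ l, c l * X (κ l) := by
  classical
  let h := killVars K (Set.range κ) f
  have hh : h.IsHomogeneous (e + 1) := by
    refine isWeightedHomogeneous_aeval (fun j => ?_) hf
    split_ifs
    · exact isWeightedHomogeneous_zero _ _ _
    · exact isWeightedHomogeneous_X _ _ _
  have h1 : f - h ∈ Ideal.span ((fun l => X (κ l)) '' ((Finset.univ : Finset (Fin m)) : Set _)) := by
    have h2 : f - h ∈ varIdeal K (Set.range κ) := by
      rw [mem_varIdeal_iff, map_sub, killVars_eq_self (killVars_mem_supported _ _), sub_self]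
    convert h2
    rw [varIdeal, ← Set.range_comp, Finset.coe_univ, Set.image_univ]
    rfl
  obtain ⟨c, hc, hc'⟩ := exists_homogeneous_coeffs (w := fun _ => 1)
    (fun l _ => isHomogeneous_X K (κ l)) (hf.sub hh) h1
  refine ⟨h, c, killVars_mem_supported _ _, hh, fun l => by simpa using hc l, ?_⟩
  rw [← hc']
  ring

end

section
open Filter

namespace Ultraprod

variable {𝒰 : Ultrafilter ℕ} {A : ℕ → Type u} [∀ i, CommRing (A i)]
  {K : ℕ → Type u} [∀ i, Field (K i)] [∀ i, Algebra (K i) (A i)]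

variable (𝒰) in
/-- The linear map induced by a family of linear maps. -/
noncomputable def mapLinear (f : ∀ i, A i →ₗ[K i] A i) :
    Ultraprod 𝒰 A →ₗ[Ultraprod 𝒰 K] Ultraprod 𝒰 A where
  toFun := map fun i => f i
  map_add' a b := by
    obtain ⟨a, rfl⟩ := mk_surjective a
    obtain ⟨b, rfl⟩ := mk_surjective b
    rw [← map_add, map_mk, map_mk, map_mk, ← map_add]
    exact mk_congr (Eventually.of_forall fun i => map_add (f i) _ _)
  map_smul' c b := by
    obtain ⟨c, rfl⟩ := mk_surjective c
    obtain ⟨b, rfl⟩ := mk_surjective b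
    rw [mk_smul_mk, map_mk, map_mk, RingHom.id_apply, mk_smul_mk]
    exact mk_congr (Eventually.of_forall fun i => map_smul (f i) _ _)

theorem mapLinear_mk (f : ∀ i, A i →ₗ[K i] A i) (a : ∀ i, A i) :
    mapLinear 𝒰 f (mk 𝒰 a) = mk 𝒰 fun i => f i (a i) := map_mk _ _

variable (𝒰) in
/-- The algebra endomorphism induced by a family of algebra endomorphisms. -/
noncomputable def mapAlgHom (f : ∀ i, A i →ₐ[K i] A i) :
    Ultraprod 𝒰 A →ₐ[Ultraprod 𝒰 K] Ultraprod 𝒰 A :=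
  AlgHom.ofLinearMap (mapLinear 𝒰 fun i => (f i).toLinearMap)
    (by
      rw [← map_one (mk 𝒰), mapLinear_mk]
      exact mk_congr (Eventually.of_forall fun i => map_one (f i)))
    (fun a b => by
      obtain ⟨a, rfl⟩ := mk_surjective a
      obtain ⟨b, rfl⟩ := mk_surjective b
      rw [← map_mul, mapLinear_mk, mapLinear_mk, mapLinear_mk, ← map_mul]
      exact mk_congr (Eventually.of_forall fun i => map_mul (f i) _ _))

theorem mapAlgHom_mk (f : ∀ i, A i →ₐ[K i] A i) (a : ∀ i, A i) :
    mapAlgHom 𝒰 f (mk 𝒰 a) = mk 𝒰 fun i => f i (a i) := map_mk _ _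

variable (𝒰) in
/-- The derivation induced by a family of derivations. -/
noncomputable def mapDerivation (D : ∀ i, Derivation (K i) (A i) (A i)) :
    Derivation (Ultraprod 𝒰 K) (Ultraprod 𝒰 A) (Ultraprod 𝒰 A) :=
  Derivation.mk' (mapLinear 𝒰 fun i => (D i).toLinearMap)
    (fun a b => by
      obtain ⟨a, rfl⟩ := mk_surjective a
      obtain ⟨b, rfl⟩ := mk_surjective b
      rw [← map_mul, mapLinear_mk, mapLinear_mk, mapLinear_mk, smul_eq_mul, smul_eq_mul,
        ← map_mul, ← map_mul, ← map_add]
      exact mk_congr (Eventually.of_forall fun i => (D i).leibniz _ _))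

theorem mapDerivation_mk (D : ∀ i, Derivation (K i) (A i) (A i)) (a : ∀ i, A i) :
    mapDerivation 𝒰 D (mk 𝒰 a) = mk 𝒰 fun i => D i (a i) := map_mk _ _

variable (𝒰) in
/-- The submodule of the classes of families of elements of a given family of submodules. -/
noncomputable def internalSubmodule (M : ∀ i, Submodule (K i) (A i)) :
    Submodule (Ultraprod 𝒰 K) (Ultraprod 𝒰 A) where
  carrier := internal 𝒰 fun i => M i
  zero_mem' := ⟨0, map_zero _, Eventually.of_forall fun i => (M i).zero_mem⟩
  add_mem' := by
    rintro _ _ ⟨a, rfl, ha⟩ ⟨b, rfl, hb⟩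
    refine ⟨a + b, map_add _ _ _, ?_⟩
    filter_upwards [ha, hb] with i h1 h2 using (M i).add_mem h1 h2
  smul_mem' := by
    rintro c _ ⟨b, rfl, hb⟩
    obtain ⟨c, rfl⟩ := mk_surjective c
    rw [mk_smul_mk]
    refine ⟨_, rfl, ?_⟩
    filter_upwards [hb] with i h2 using (M i).smul_mem _ h2

theorem mk_mem_internalSubmodule {M : ∀ i, Submodule (K i) (A i)} {a : ∀ i, A i} :
    mk 𝒰 a ∈ internalSubmodule 𝒰 M ↔ ∀ᶠ i in 𝒰, a i ∈ M i := mk_mem_internal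

variable (𝒰) in
/-- The subalgebra of the classes of families of elements of a given family of subalgebras. -/
noncomputable def internalSubalgebra (M : ∀ i, Subalgebra (K i) (A i)) :
    Subalgebra (Ultraprod 𝒰 K) (Ultraprod 𝒰 A) :=
  Submodule.toSubalgebra (internalSubmodule 𝒰 fun i => Subalgebra.toSubmodule (M i))
    ⟨1, map_one _, Eventually.of_forall fun i => (M i).one_mem⟩
    (by
      rintro _ _ ⟨a, rfl, ha⟩ ⟨b, rfl, hb⟩
      refine ⟨a * b, map_mul _ _ _, ?_⟩
      filter_upwards [ha, hb] with i h1 h2 using (M i).mul_mem h1 h2)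

theorem mk_mem_internalSubalgebra {M : ∀ i, Subalgebra (K i) (A i)} {a : ∀ i, A i} :
    mk 𝒰 a ∈ internalSubalgebra 𝒰 M ↔ ∀ᶠ i in 𝒰, a i ∈ M i := mk_mem_internal

variable (𝒰) in
/-- The ideal of the classes of families of elements of a given family of ideals. -/
def internalIdeal (P : ∀ i, Ideal (A i)) : Ideal (Ultraprod 𝒰 A) where
  carrier := internal 𝒰 fun i => P i
  zero_mem' := ⟨0, map_zero _, Eventually.of_forall fun i => (P i).zero_mem⟩
  add_mem' := by
    rintro _ _ ⟨a, rfl, ha⟩ ⟨b, rfl, hb⟩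
    refine ⟨a + b, map_add _ _ _, ?_⟩
    filter_upwards [ha, hb] with i h1 h2 using (P i).add_mem h1 h2
  smul_mem' := by
    rintro c _ ⟨b, rfl, hb⟩
    obtain ⟨c, rfl⟩ := mk_surjective c
    refine ⟨c * b, map_mul _ _ _, ?_⟩
    filter_upwards [hb] with i h2 using (P i).mul_mem_left _ h2

theorem mk_mem_internalIdeal {P : ∀ i, Ideal (A i)} {a : ∀ i, A i} :
    mk 𝒰 a ∈ internalIdeal 𝒰 P ↔ ∀ᶠ i in 𝒰, a i ∈ P i := mk_mem_internal

theorem internalIdeal_isPrime {P : ∀ i, Ideal (A i)} (hP : ∀ i, (P i).IsPrime) :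
    (internalIdeal 𝒰 P).IsPrime := by
  refine ⟨?_, fun {a b} h => ?_⟩
  · rw [Ne, Ideal.eq_top_iff_one, ← map_one (mk 𝒰), mk_mem_internalIdeal]
    intro h
    obtain ⟨i, hi⟩ := h.exists
    exact (hP i).ne_top ((Ideal.eq_top_iff_one _).2 hi)
  · obtain ⟨a, rfl⟩ := mk_surjective a
    obtain ⟨b, rfl⟩ := mk_surjective b
    rw [← map_mul, mk_mem_internalIdeal] at h
    rw [mk_mem_internalIdeal, mk_mem_internalIdeal, ← Ultrafilter.eventually_or]
    exact h.mono fun i hi => (hP i).mem_or_mem hi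

end Ultraprod

end

section
open Filter

namespace Ultraprod

variable (𝒰 : Ultrafilter ℕ) (K : ℕ → Type u) [∀ i, Field (K i)] (N : ℕ → ℕ)

/-- The ultraproduct of a sequence of polynomial rings. -/
abbrev Poly : Type u := Ultraprod 𝒰 fun i => MvPolynomial (Fin (N i)) (K i)

/-- The classes of families of forms of a given degree. -/
noncomputable def form (e : ℕ) : Submodule (Ultraprod 𝒰 K) (Poly 𝒰 K N) :=
  internalSubmodule 𝒰 fun i => homogeneousSubmodule (Fin (N i)) (K i) e

/-- The homogeneous component in an ultraproduct of polynomial rings. -/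
noncomputable def component (e : ℕ) : Poly 𝒰 K N →ₗ[Ultraprod 𝒰 K] Poly 𝒰 K N :=
  mapLinear 𝒰 fun _ => homogeneousComponent e

variable {K N} in
/-- The translation in an ultraproduct of polynomial rings. -/
noncomputable def translation (c : ∀ i, Fin (N i) → K i) :
    Poly 𝒰 K N →ₐ[Ultraprod 𝒰 K] Poly 𝒰 K N :=
  mapAlgHom 𝒰 fun i => aeval fun j => X j + C (c i j)

variable {N} in
/-- The partial derivative in an ultraproduct of polynomial rings. -/
noncomputable def partialDeriv (κ : ∀ i, Fin (N i)) :
    Derivation (Ultraprod 𝒰 K) (Poly 𝒰 K N) (Poly 𝒰 K N) :=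
  mapDerivation 𝒰 fun i => pderiv (κ i)

variable {𝒰 K N}

theorem mk_mem_form {e : ℕ} {f : ∀ i, MvPolynomial (Fin (N i)) (K i)} :
    mk 𝒰 f ∈ form 𝒰 K N e ↔ ∀ᶠ i in 𝒰, (f i).IsHomogeneous e := mk_mem_internalSubmodule

theorem mk_mem_iSup_form {e : ℕ} {f : ∀ i, MvPolynomial (Fin (N i)) (K i)}
    (hf : ∀ᶠ i in 𝒰, f i ∈ weightLT 1 e) : mk 𝒰 f ∈ ⨆ i : Fin e, form 𝒰 K N i := by
  have h : mk 𝒰 f = ∑ j ∈ Finset.range e, mk 𝒰 fun i => homogeneousComponent j (f i) := by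
    rw [mk_sum]
    refine mk_congr ?_
    filter_upwards [hf] with i hi
    rw [sum_homogeneousComponent_of_mem_weightLT hi]
  rw [h]
  refine Submodule.sum_mem _ fun j hj => ?_
  refine Submodule.mem_iSup_of_mem (⟨j, Finset.mem_range.1 hj⟩ : Fin e) ?_
  exact mk_mem_form.2 (Eventually.of_forall fun i => homogeneousComponent_isHomogeneous _ _)

theorem isUnipotentGrading_form [∀ i, IsAlgClosed (K i)] :
    IsUnipotentGrading (form 𝒰 K N) (component 𝒰 K N) (Set.range (translation 𝒰)) where
  zero := by
    ext a
    obtain ⟨f, rfl⟩ := mk_surjective a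
    rw [mk_mem_form, Submodule.mem_one]
    constructor
    · intro h
      refine ⟨mk 𝒰 fun i => coeff 0 (f i), ?_⟩
      rw [algebraMap_mk, mk_eq_mk]
      filter_upwards [h] with i hi
      have := Nat.le_zero.1 hi.totalDegree_le
      rw [totalDegree_eq_zero_iff_eq_C] at this
      rw [algebraMap_eq, ← this]
    · rintro ⟨c, hc⟩
      obtain ⟨c, rfl⟩ := mk_surjective c
      rw [algebraMap_mk, mk_eq_mk] at hc
      filter_upwards [hc] with i hi
      rw [← hi]
      exact isHomogeneous_C _ _
  mul a b := by
    rw [Submodule.mul_le]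
    intro x hx y hy
    obtain ⟨f, rfl⟩ := mk_surjective x
    obtain ⟨g, rfl⟩ := mk_surjective y
    rw [← map_mul, mk_mem_form]
    filter_upwards [mk_mem_form.1 hx, mk_mem_form.1 hy] with i h1 h2 using h1.mul h2
  comp_self e a ha := by
    obtain ⟨f, rfl⟩ := mk_surjective a
    rw [component, mapLinear_mk, mk_eq_mk]
    filter_upwards [mk_mem_form.1 ha] with i hi
    rw [homogeneousComponent_of_mem hi, if_pos rfl]
  comp_ne e e' he a ha := by
    obtain ⟨f, rfl⟩ := mk_surjective a
    rw [component, mapLinear_mk, mk_eq_zero]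
    filter_upwards [mk_mem_form.1 ha] with i hi
    rw [homogeneousComponent_of_mem hi, if_neg he.symm]
  trans := by
    rintro _ ⟨c, rfl⟩ e a ha
    obtain ⟨f, rfl⟩ := mk_surjective a
    rw [translation, mapAlgHom_mk, ← map_sub]
    refine mk_mem_iSup_form ?_
    filter_upwards [mk_mem_form.1 ha] with i hi using translate_sub_mem_weightLT hi _
  fixed e he a ha h := by
    classical
    obtain ⟨f, rfl⟩ := mk_surjective a
    have h1 : ∀ i, ∃ c : Fin (N i) → K i, (f i).IsHomogeneous e → f i ≠ 0 →
        aeval (fun j => X j + C (c j)) (f i) ≠ f i := fun i => by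
      by_cases h : (f i).IsHomogeneous e ∧ f i ≠ 0
      · obtain ⟨c, hc⟩ := exists_translate_ne he h.1 h.2
        exact ⟨c, fun _ _ => hc⟩
      · exact ⟨0, fun h1 h2 => absurd ⟨h1, h2⟩ h⟩
    choose c hc using h1
    have h2 := h _ ⟨c, rfl⟩
    rw [translation, mapAlgHom_mk, mk_eq_mk] at h2
    rw [mk_eq_zero]
    filter_upwards [h2, mk_mem_form.1 ha] with i h3 h4
    by_contra h5
    exact hc i h4 h5 h3

theorem partialDeriv_mem_form {e : ℕ} {a : Poly 𝒰 K N} (ha : a ∈ form 𝒰 K N e)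
    (κ : ∀ i, Fin (N i)) : partialDeriv 𝒰 K κ a ∈ form 𝒰 K N (e - 1) := by
  obtain ⟨f, rfl⟩ := mk_surjective a
  rw [partialDeriv, mapDerivation_mk, mk_mem_form]
  filter_upwards [mk_mem_form.1 ha] with i hi using hi.pderiv

section GeneratingSystem

variable {J : Type u} {w : J → ℕ} {y : J → Poly 𝒰 K N} [∀ i, IsAlgClosed (K i)]

theorem exists_aeval_eq_mk (hy : IsGeneratingSystem (form 𝒰 K N) w y) {n : ℕ}
    {f : ∀ i, MvPolynomial (Fin (N i)) (K i)} (hf : ∀ᶠ i in 𝒰, f i ∈ weightLT 1 n) :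
    ∃ g ∈ (weightLT w n : Submodule _ (MvPolynomial J (Ultraprod 𝒰 K))), aeval y g = mk 𝒰 f :=
  hy.exists_aeval_eq_of_mem_iSup isUnipotentGrading_form (mk_mem_iSup_form hf)

theorem exists_mk_eq_aeval (hy : IsGeneratingSystem (form 𝒰 K N) w y) {n : ℕ}
    {g : MvPolynomial J (Ultraprod 𝒰 K)} (hg : g ∈ weightLT w n) :
    ∃ f : ∀ i, MvPolynomial (Fin (N i)) (K i), mk 𝒰 f = aeval y g ∧
      ∀ᶠ i in 𝒰, f i ∈ weightLT 1 n := by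
  suffices aeval y g ∈ internalSubmodule 𝒰 fun i =>
    (weightLT 1 n : Submodule (K i) (MvPolynomial (Fin (N i)) (K i))) from this
  rw [g.as_sum, map_sum]
  refine Submodule.sum_mem _ fun m hm => ?_
  have h1 := hy.aeval_mem isUnipotentGrading_form
    (isWeightedHomogeneous_monomial w m (coeff m g) rfl)
  obtain ⟨f, hf⟩ := mk_surjective (aeval y (monomial m (coeff m g)))
  rw [← hf, mk_mem_form] at h1
  rw [← hf, mk_mem_internalSubmodule]
  filter_upwards [h1] with i hi
  exact weightLT_mono (mem_weightLT.1 hg m (mem_support_iff.1 hm))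
    (IsWeightedHomogeneous.mem_weightLT hi)

theorem exists_derivation (hy : IsGeneratingSystem (form 𝒰 K N) w y) :
    ∃ D : (∀ i, Fin (N i)) → Derivation (Ultraprod 𝒰 K) (MvPolynomial J (Ultraprod 𝒰 K))
        (MvPolynomial J (Ultraprod 𝒰 K)),
      (∀ κ j, IsWeightedHomogeneous w (D κ (X j)) (w j - 1)) ∧
      ∀ κ f, aeval y (D κ f) = partialDeriv 𝒰 K κ (aeval y f) := by
  choose g hg hg' using fun κ j => hy.exists_aeval_eq isUnipotentGrading_form _
    (partialDeriv_mem_form (hy.mem j) κ)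
  refine ⟨fun κ => mkDerivation _ (g κ), fun κ j => ?_, fun κ f => ?_⟩
  · rw [mkDerivation_X]
    exact hg κ j
  · induction f using MvPolynomial.induction_on with
    | C a => rw [← algebraMap_eq, AlgHom.commutes, Derivation.map_algebraMap,
        Derivation.map_algebraMap, map_zero]
    | add p q hp hq => simp only [map_add, hp, hq]
    | mul_X p j hp =>
      rw [Derivation.leibniz, map_mul, Derivation.leibniz, map_add, mkDerivation_X, smul_eq_mul,
        smul_eq_mul, map_mul, map_mul, hp, hg', aeval_X]
      rfl

end GeneratingSystem

end Ultraprod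

end

section
open Filter

namespace Ultraprod

variable {𝒰 : Ultrafilter ℕ} {K : ℕ → Type u} [∀ i, Field (K i)] {N : ℕ → ℕ}
variable {J : Type u} {w : J → ℕ} {y : J → Poly 𝒰 K N}

theorem aeval_injective [∀ i, IsAlgClosed (K i)] (hy : IsGeneratingSystem (form 𝒰 K N) w y) :
    Function.Injective (aeval y : MvPolynomial J (Ultraprod 𝒰 K) →ₐ[_] Poly 𝒰 K N) :=
  (injective_iff_map_eq_zero _).2 fun _ h =>
    hy.eq_zero_of_aeval_eq_zero isUnipotentGrading_form h

theorem mem_span_of_mem_varIdeal {V : Set J} {Y : J → ∀ i, MvPolynomial (Fin (N i)) (K i)}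
    (hY : ∀ j, mk 𝒰 (Y j) = y j) {g : MvPolynomial J (Ultraprod 𝒰 K)}
    (hg : g ∈ varIdeal (Ultraprod 𝒰 K) V) {f : ∀ i, MvPolynomial (Fin (N i)) (K i)}
    (hf : mk 𝒰 f = aeval y g) : ∀ᶠ i in 𝒰, f i ∈ Ideal.span ((fun j => Y j i) '' V) := by
  suffices aeval y g ∈ internalIdeal 𝒰 fun i => Ideal.span ((fun j => Y j i) '' V) by
    rwa [← hf, mk_mem_internalIdeal] at this
  suffices varIdeal (Ultraprod 𝒰 K) V ≤
    (internalIdeal 𝒰 fun i => Ideal.span ((fun j => Y j i) '' V)).comap (aeval y) from this hg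
  refine Ideal.span_le.2 ?_
  rintro _ ⟨j, hj, rfl⟩
  rw [SetLike.mem_coe, Ideal.mem_comap, aeval_X, ← hY, mk_mem_internalIdeal]
  exact Eventually.of_forall fun i => Ideal.subset_span ⟨j, hj, rfl⟩

theorem cast_mul_mem_varIdeal [∀ i, IsAlgClosed (K i)] [∀ i, NeZero (N i)]
    (hy : IsGeneratingSystem (form 𝒰 K N) w y)
    {D : (∀ i, Fin (N i)) → Derivation (Ultraprod 𝒰 K) (MvPolynomial J (Ultraprod 𝒰 K))
        (MvPolynomial J (Ultraprod 𝒰 K))}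
    (hD : ∀ κ f, aeval y (D κ f) = partialDeriv 𝒰 K κ (aeval y f))
    (V : Finset J) (e : ℕ) (F : MvPolynomial J (Ultraprod 𝒰 K)) (hF : IsWeightedHomogeneous w F e)
    (h : ∀ κ, D κ F ∈ varIdeal (Ultraprod 𝒰 K) (V : Set J)) :
    (e : MvPolynomial J (Ultraprod 𝒰 K)) * F ∈ varIdeal (Ultraprod 𝒰 K) (V : Set J) := by
  classical
  choose Y hY using fun j => mk_surjective (y j)
  obtain ⟨f, hf⟩ := mk_surjective (aeval y F)
  have hfh := hy.aeval_mem isUnipotentGrading_form hF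
  rw [← hf, mk_mem_form] at hfh
  have hYh : ∀ᶠ i in 𝒰, ∀ j ∈ V, (Y j i).IsHomogeneous (w j) := by
    refine (eventually_all_finset V).2 fun j _ => ?_
    have := hy.mem j
    rwa [← hY, mk_mem_form] at this
  have h1 : ∀ i, ∃ κ, pderiv κ (f i) ∈ Ideal.span ((fun j => Y j i) '' (V : Set J)) →
      ∀ κ, pderiv κ (f i) ∈ Ideal.span ((fun j => Y j i) '' (V : Set J)) := fun i => by
    by_cases h2 : ∃ κ, pderiv κ (f i) ∉ Ideal.span ((fun j => Y j i) '' (V : Set J))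
    · obtain ⟨κ, hκ⟩ := h2
      exact ⟨κ, fun h => absurd h hκ⟩
    · push Not at h2
      exact ⟨0, fun _ => h2⟩
  choose κ hκ using h1
  have h2 := mem_span_of_mem_varIdeal hY (h κ) (f := fun i => pderiv (κ i) (f i))
    (by rw [hD, ← hf, partialDeriv, mapDerivation_mk])
  have h3 : ∀ i, ∃ c : J → MvPolynomial (Fin (N i)) (K i),
      (pderiv (κ i) (f i) ∈ Ideal.span ((fun j => Y j i) '' (V : Set J))) →
      (f i).IsHomogeneous e → (∀ j ∈ V, (Y j i).IsHomogeneous (w j)) →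
      (∀ j, (c j).IsHomogeneous (e - w j)) ∧ e • f i = ∑ j ∈ V, c j * Y j i := fun i => by
    by_cases h4 : (pderiv (κ i) (f i) ∈ Ideal.span ((fun j => Y j i) '' (V : Set J))) ∧
      (f i).IsHomogeneous e ∧ (∀ j ∈ V, (Y j i).IsHomogeneous (w j))
    · obtain ⟨h5, h6, h7⟩ := h4
      have h8 : e • f i ∈ Ideal.span ((fun j => Y j i) '' (V : Set J)) := by
        rw [← h6.sum_X_mul_pderiv]
        exact Ideal.sum_mem _ fun l _ => Ideal.mul_mem_left _ _ (hκ i h5 l)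
      obtain ⟨c, hc⟩ := exists_homogeneous_coeffs h7
        ((homogeneousSubmodule _ _ e).nsmul_mem h6 e) h8
      exact ⟨c, fun _ _ _ => hc⟩
    · exact ⟨0, fun h5 h6 h7 => absurd ⟨h5, h6, h7⟩ h4⟩
  choose c hc using h3
  have h4 : ∀ᶠ i in 𝒰, (∀ j, (c i j).IsHomogeneous (e - w j)) ∧
      e • f i = ∑ j ∈ V, c i j * Y j i := by
    filter_upwards [h2, hfh, hYh] with i h5 h6 h7 using hc i h5 h6 h7
  choose g hg hg' using fun j => hy.exists_aeval_eq isUnipotentGrading_form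
    (mk 𝒰 fun i => c i j) (mk_mem_form.2 (h4.mono fun i hi => hi.1 j))
  have h5 : (e : MvPolynomial J (Ultraprod 𝒰 K)) * F = ∑ j ∈ V, g j * X j := by
    refine aeval_injective hy ?_
    simp only [map_mul, map_natCast, map_sum, aeval_X, hg', ← hf, ← hY]
    rw [← nsmul_eq_mul, ← map_nsmul]
    simp_rw [← map_mul]
    rw [mk_sum, mk_eq_mk]
    filter_upwards [h4] with i hi
    exact hi.2
  rw [h5]
  exact Ideal.sum_mem _ fun j hj => Ideal.mul_mem_left _ _ (Ideal.subset_span ⟨j, hj, rfl⟩)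

end Ultraprod

end

section
open Filter

namespace Ultraprod

variable {𝒰 : Ultrafilter ℕ} {K : ℕ → Type u} [∀ i, Field (K i)] {N : ℕ → ℕ}
variable {J : Type u} {w : J → ℕ} {y : J → Poly 𝒰 K N}

/-- The polynomials whose value is represented by polynomials not involving finitely many given
variables. -/
noncomputable def constants (y : J → Poly 𝒰 K N) {m : ℕ} (κ : Fin m → ∀ i, Fin (N i)) :
    Subalgebra (Ultraprod 𝒰 K) (MvPolynomial J (Ultraprod 𝒰 K)) :=
  (internalSubalgebra 𝒰 fun i => supported (K i) (Set.range fun l => κ l i)ᶜ).comap (aeval y)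

theorem mem_constants {m : ℕ} {κ : Fin m → ∀ i, Fin (N i)} {a : MvPolynomial J (Ultraprod 𝒰 K)}
    {f : ∀ i, MvPolynomial (Fin (N i)) (K i)} (hf : mk 𝒰 f = aeval y a) :
    a ∈ constants y κ ↔ ∀ᶠ i in 𝒰, f i ∈ supported (K i) (Set.range fun l => κ l i)ᶜ := by
  rw [← mk_mem_internalSubalgebra (𝒰 := 𝒰), hf]
  rfl

variable [∀ i, IsAlgClosed (K i)] {D : (∀ i, Fin (N i)) → Derivation (Ultraprod 𝒰 K)
    (MvPolynomial J (Ultraprod 𝒰 K)) (MvPolynomial J (Ultraprod 𝒰 K))}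

theorem adjoin_constants_eq_top (hy : IsGeneratingSystem (form 𝒰 K N) w y) {m : ℕ}
    (κ : Fin m → ∀ i, Fin (N i)) {x : Fin m → MvPolynomial J (Ultraprod 𝒰 K)}
    (hx : ∀ l, aeval y (x l) = mk 𝒰 fun i => X (κ l i)) :
    Algebra.adjoin (constants y κ) (Set.range x) = ⊤ := by
  have hS : ∀ a ∈ constants y κ, a ∈ Algebra.adjoin (constants y κ) (Set.range x) := fun a ha =>
    (Algebra.adjoin (constants y κ) (Set.range x)).algebraMap_mem (⟨a, ha⟩ : constants y κ)
  have key : ∀ e, ∀ g : MvPolynomial J (Ultraprod 𝒰 K), IsWeightedHomogeneous w g e →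
      g ∈ Algebra.adjoin (constants y κ) (Set.range x) := by
    intro e
    induction e with
    | zero =>
      intro g hg
      have h1 := hy.aeval_mem isUnipotentGrading_form hg
      rw [isUnipotentGrading_form.zero, Submodule.mem_one] at h1
      obtain ⟨c, hc⟩ := h1
      have h2 : g = algebraMap _ _ c := aeval_injective hy (by rw [AlgHom.commutes, hc])
      exact hS _ (h2 ▸ Subalgebra.algebraMap_mem _ c)
    | succ e ih =>
      intro g hg
      obtain ⟨f, hf⟩ := mk_surjective (aeval y g)
      have hfh := hy.aeval_mem isUnipotentGrading_form hg
      rw [← hf, mk_mem_form] at hfh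
      have h1 : ∀ i, ∃ (h : MvPolynomial (Fin (N i)) (K i)) (c : Fin m → _),
          (f i).IsHomogeneous (e + 1) → h ∈ supported (K i) (Set.range fun l => κ l i)ᶜ ∧
          h.IsHomogeneous (e + 1) ∧ (∀ l, (c l).IsHomogeneous e) ∧
          f i = h + ∑ l, c l * X (κ l i) := fun i => by
        by_cases hi : (f i).IsHomogeneous (e + 1)
        · obtain ⟨h, c, hc⟩ := exists_eq_add_sum_mul_X hi fun l => κ l i
          exact ⟨h, c, fun _ => hc⟩
        · exact ⟨0, 0, fun h => absurd h hi⟩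
      choose h c hc using h1
      obtain ⟨h', -, hh'⟩ := hy.exists_aeval_eq isUnipotentGrading_form (mk 𝒰 h)
        (mk_mem_form.2 (hfh.mono fun i hi => (hc i hi).2.1))
      choose c' hch hc' using fun l => hy.exists_aeval_eq isUnipotentGrading_form
        (mk 𝒰 fun i => c i l) (mk_mem_form.2 (hfh.mono fun i hi => (hc i hi).2.2.1 l))
      have h2 : g = h' + ∑ l, c' l * x l := by
        refine aeval_injective hy ?_
        simp only [map_add, map_sum, map_mul, hh', hc', hx, ← hf]
        simp_rw [← map_mul]
        rw [mk_sum, ← map_add, mk_eq_mk]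
        filter_upwards [hfh] with i hi
        exact (hc i hi).2.2.2
      rw [h2]
      refine add_mem (hS _ ?_) (sum_mem fun l _ => mul_mem (ih _ (hch l))
        (Algebra.subset_adjoin ⟨l, rfl⟩))
      exact (mem_constants hh'.symm).2 (hfh.mono fun i hi => (hc i hi).1)
  rw [eq_top_iff]
  rintro g -
  rw [g.as_sum]
  exact sum_mem fun m _ => key _ _ (isWeightedHomogeneous_monomial w m _ rfl)

theorem exists_pow_eq_of_mem_constants [∀ i, NeZero (N i)]
    (hy : IsGeneratingSystem (form 𝒰 K N) w y)
    (hD : ∀ κ f, aeval y (D κ f) = partialDeriv 𝒰 K κ (aeval y f)) {m : ℕ}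
    (κ : Fin m → ∀ i, Fin (N i)) (p : ℕ) [hp : Fact p.Prime] [CharP (Ultraprod 𝒰 K) p]
    {a : MvPolynomial J (Ultraprod 𝒰 K)} (ha : a ∈ constants y κ) (h : ∀ μ, D μ a = 0) :
    ∃ b ∈ constants y κ, b ^ p = a := by
  obtain ⟨n, hn⟩ := exists_mem_weightLT (w := w) a
  obtain ⟨f, hf, hfn⟩ := exists_mk_eq_aeval hy (weightLT_mono (Nat.le_add_right n 2) hn)
  have hfS := (mem_constants hf).1 ha
  have hchar : ∀ᶠ i in 𝒰, CharP (K i) p := by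
    have h1 : mk 𝒰 (p : ∀ i, K i) = 0 := by rw [map_natCast, CharP.cast_eq_zero]
    filter_upwards [mk_eq_zero.1 h1] with i hi
    exact (CharP.charP_iff_prime_eq_zero hp.out).2 hi
  have h1 : ∀ i, ∃ μ, pderiv μ (f i) = 0 → ∀ μ, pderiv μ (f i) = 0 := fun i => by
    by_cases h2 : ∃ μ, pderiv μ (f i) ≠ 0
    · obtain ⟨μ, hμ⟩ := h2
      exact ⟨μ, fun h => absurd h hμ⟩
    · push Not at h2
      exact ⟨0, fun _ => h2⟩
  choose μ hμ using h1
  have h2 := hD μ a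
  rw [h μ, map_zero, ← hf, partialDeriv, mapDerivation_mk, eq_comm, mk_eq_zero] at h2
  have h3 : ∀ i, ∃ b, CharP (K i) p → pderiv (μ i) (f i) = 0 → f i ∈ weightLT 1 (n + 2) →
      f i ∈ supported (K i) (Set.range fun l => κ l i)ᶜ →
      b ∈ supported (K i) (Set.range fun l => κ l i)ᶜ ∧ b ^ p = f i ∧ b ∈ weightLT 1 (n + 1) := by
    intro i
    by_cases h4 : CharP (K i) p ∧ pderiv (μ i) (f i) = 0 ∧ f i ∈ weightLT 1 (n + 2) ∧
      f i ∈ supported (K i) (Set.range fun l => κ l i)ᶜ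
    · obtain ⟨h5, h6, h7, h8⟩ := h4
      obtain ⟨b, hb, hb'⟩ := exists_pow_char_eq_of_mem_supported p h8 (hμ i h6)
      exact ⟨b, fun _ _ _ _ => ⟨hb, hb', mem_weightLT_of_pow (p := p) (by rwa [hb'])⟩⟩
    · exact ⟨0, fun h5 h6 h7 h8 => absurd ⟨h5, h6, h7, h8⟩ h4⟩
  choose b hb using h3
  have h4 : ∀ᶠ i in 𝒰, b i ∈ supported (K i) (Set.range fun l => κ l i)ᶜ ∧ b i ^ p = f i ∧
      b i ∈ weightLT 1 (n + 1) := by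
    filter_upwards [hchar, h2, hfn, hfS] with i h5 h6 h7 h8 using hb i h5 h6 h7 h8
  obtain ⟨b', -, hb'⟩ := exists_aeval_eq_mk hy (h4.mono fun i hi => hi.2.2)
  refine ⟨b', (mem_constants hb'.symm).2 (h4.mono fun i hi => hi.1), aeval_injective hy ?_⟩
  rw [map_pow, hb', ← map_pow, ← hf, mk_eq_mk]
  exact h4.mono fun i hi => hi.2.1

theorem exists_mk_X (hy : IsGeneratingSystem (form 𝒰 K N) w y) {m : ℕ}
    (κ : Fin m → ∀ i, Fin (N i)) : ∃ x : Fin m → MvPolynomial J (Ultraprod 𝒰 K),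
      ∀ l, aeval y (x l) = mk 𝒰 fun i => X (κ l i) := by
  choose x _ hx using fun l => hy.exists_aeval_eq isUnipotentGrading_form
    (mk 𝒰 fun i => (X (κ l i) : MvPolynomial (Fin (N i)) (K i)))
    (mk_mem_form.2 (Eventually.of_forall fun i => isHomogeneous_X _ _))
  exact ⟨x, hx⟩

theorem isCoordinateFamily [∀ i, NeZero (N i)] (hy : IsGeneratingSystem (form 𝒰 K N) w y)
    (hDX : ∀ κ j, IsWeightedHomogeneous w (D κ (X j)) (w j - 1))
    (hD : ∀ κ f, aeval y (D κ f) = partialDeriv 𝒰 K κ (aeval y f)) :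
    IsCoordinateFamily w D where
  homog := hDX
  pos := hy.pos
  euler := cast_mul_mem_varIdeal hy hD
  coords {m} κ hκ := by
    classical
    obtain ⟨x, hx⟩ := exists_mk_X hy κ
    refine ⟨constants y κ, x, fun l a ha => ?_, fun μ a ha => ?_, fun l l' => ?_,
      adjoin_constants_eq_top hy κ hx, fun p _ _ a ha => exists_pow_eq_of_mem_constants hy hD κ p ha⟩
    · refine aeval_injective hy ?_
      obtain ⟨f, hf⟩ := mk_surjective (aeval y a)
      rw [hD, ← hf, partialDeriv, mapDerivation_mk, map_zero, mk_eq_zero]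
      filter_upwards [(mem_constants hf).1 ha] with i hi
      refine pderiv_eq_zero_of_notMem_vars fun h => ?_
      exact mem_supported.1 hi h ⟨l, rfl⟩
    · obtain ⟨f, hf⟩ := mk_surjective (aeval y a)
      rw [mem_constants (f := fun i => pderiv (μ i) (f i))
        (by rw [hD, ← hf, partialDeriv, mapDerivation_mk])]
      filter_upwards [(mem_constants hf).1 ha] with i hi using pderiv_mem_supported hi _
    · refine aeval_injective hy ?_
      rw [hD, hx, partialDeriv, mapDerivation_mk]
      split_ifs with h
      · rw [map_one, h, ← map_one (mk 𝒰)]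
        refine mk_congr (Eventually.of_forall fun i => ?_)
        rw [pderiv_X_self]
        rfl
      · rw [map_zero, mk_eq_zero]
        have h1 : ∀ᶠ i in 𝒰, κ l i ≠ κ l' i := by
          rw [Ultrafilter.eventually_not]
          intro h2
          refine h (hκ (DFunLike.ext _ _ fun a => aeval_injective hy ?_))
          obtain ⟨f, hf⟩ := mk_surjective (aeval y a)
          rw [hD, hD, ← hf, partialDeriv, partialDeriv, mapDerivation_mk, mapDerivation_mk, mk_eq_mk]
          filter_upwards [h2] with i hi
          rw [hi]
        filter_upwards [h1] with i hi
        exact pderiv_X_of_ne hi.symm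

end Ultraprod

end

section
variable {σ K : Type*} [Field K]

/-- A polynomial viewed as a polynomial in one of its variables. -/
noncomputable def asPolynomialIn [DecidableEq σ] (j : σ) :
    MvPolynomial σ K →ₐ[K] Polynomial (MvPolynomial σ K) :=
  aeval fun i => if i = j then Polynomial.X else Polynomial.C (X i)

theorem asPolynomialIn_injective [DecidableEq σ] (j : σ) :
    Function.Injective (asPolynomialIn (K := K) j) := by
  have h : (((Polynomial.aeval (X j : MvPolynomial σ K)).restrictScalars K).comp
      (asPolynomialIn (K := K) j)) = AlgHom.id K _ := by
    refine algHom_ext fun i => ?_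
    rw [AlgHom.comp_apply, asPolynomialIn, aeval_X]
    split_ifs with h
    · simp [h]
    · simp
  refine Function.LeftInverse.injective
    (g := (Polynomial.aeval (X j : MvPolynomial σ K)).restrictScalars K) fun f => ?_
  exact DFunLike.congr_fun h f

theorem asPolynomialIn_of_mem_supported [DecidableEq σ] {j : σ} {s : Set σ} (hj : j ∉ s)
    {f : MvPolynomial σ K} (hf : f ∈ supported K s) : asPolynomialIn j f = Polynomial.C f := by
  induction hf using Algebra.adjoin_induction with
  | mem x hx =>
    obtain ⟨i, hi, rfl⟩ := hx
    rw [asPolynomialIn, aeval_X, if_neg (ne_of_mem_of_not_mem hi hj)]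
  | algebraMap c => rw [AlgHom.commutes]; rfl
  | add x y _ _ hx hy => rw [map_add, hx, hy, map_add]
  | mul x y _ _ hx hy => rw [map_mul, hx, hy, map_mul]

theorem coeff_asPolynomialIn_mem_supported [DecidableEq σ] {j : σ} {s : Set σ}
    {f : MvPolynomial σ K} (hf : f ∈ supported K s) (n : ℕ) :
    (asPolynomialIn j f).coeff n ∈ supported K (s \ {j}) := by
  induction hf using Algebra.adjoin_induction generalizing n with
  | mem x hx =>
    obtain ⟨i, hi, rfl⟩ := hx
    rw [asPolynomialIn, aeval_X]
    split_ifs with h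
    · rw [Polynomial.coeff_X]
      split_ifs
      exacts [one_mem _, zero_mem _]
    · rw [Polynomial.coeff_C]
      split_ifs
      exacts [Algebra.subset_adjoin ⟨i, ⟨hi, h⟩, rfl⟩, zero_mem _]
  | algebraMap c =>
    rw [AlgHom.commutes, IsScalarTower.algebraMap_apply K (MvPolynomial σ K),
      Polynomial.algebraMap_eq, Polynomial.coeff_C]
    split_ifs
    exacts [Subalgebra.algebraMap_mem _ c, zero_mem _]
  | add x y _ _ hx hy => rw [map_add, Polynomial.coeff_add]; exact add_mem (hx n) (hy n)
  | mul x y _ _ hx hy =>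
    rw [map_mul, Polynomial.coeff_mul]
    exact sum_mem fun p _ => mul_mem (hx _) (hy _)

/-- The ideal generated by the elements of an ideal which only involve given variables. -/
noncomputable def supportedIdeal (P : Ideal (MvPolynomial σ K)) (s : Set σ) : Ideal (MvPolynomial σ K) :=
  Ideal.span {f | f ∈ P ∧ f ∈ supported K s}

theorem supportedIdeal_le (P : Ideal (MvPolynomial σ K)) (s : Set σ) : supportedIdeal P s ≤ P :=
  Ideal.span_le.2 fun _ h => h.1

theorem supportedIdeal_mono (P : Ideal (MvPolynomial σ K)) {s t : Set σ} (h : s ⊆ t) :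
    supportedIdeal P s ≤ supportedIdeal P t :=
  Ideal.span_mono fun _ hf => ⟨hf.1, supported_mono h hf.2⟩

theorem coeff_asPolynomialIn_mem [DecidableEq σ] {P : Ideal (MvPolynomial σ K)} {s : Set σ} {j : σ}
    (hj : j ∉ s) {f : MvPolynomial σ K} (hf : f ∈ supportedIdeal P s) (n : ℕ) :
    (asPolynomialIn j f).coeff n ∈ P := by
  have h : supportedIdeal P s ≤ (P.map Polynomial.C).comap (asPolynomialIn j) := by
    refine Ideal.span_le.2 fun g hg => ?_
    rw [SetLike.mem_coe, Ideal.mem_comap, asPolynomialIn_of_mem_supported hj hg.2]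
    exact Ideal.mem_map_of_mem _ hg.1
  exact Ideal.mem_map_C_iff.1 (h hf) n

end

section
variable {σ K : Type*} [Field K]

theorem supportedIdeal_isPrime {P : Ideal (MvPolynomial σ K)} (hP : P.IsPrime) (s : Set σ) :
    (supportedIdeal P s).IsPrime := by
  have h := isPrime_map_rename_subtype s
    (hP.comap (rename Subtype.val : MvPolynomial s K →ₐ[K] MvPolynomial σ K))
  convert h using 1
  rw [supportedIdeal, Ideal.map]
  congr 1
  ext f
  rw [supported_eq_range_rename]
  constructor
  · rintro ⟨h1, g, rfl⟩
    exact ⟨g, h1, rfl⟩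
  · rintro ⟨g, h1, rfl⟩
    exact ⟨h1, g, rfl⟩

end

section
variable {K : Type*} [Field K] {N : ℕ}

theorem card_le_height_supportedIdeal {P : Ideal (MvPolynomial (Fin N) K)}
    [∀ n, (supportedIdeal P {i : Fin N | (i : ℕ) < n}).IsPrime] (n : ℕ) :
    ({i : Fin N | supportedIdeal P {l | l < i} ≠ supportedIdeal P {l | l ≤ i} ∧ (i : ℕ) < n}.ncard :
      ℕ∞) ≤ (supportedIdeal P {i : Fin N | (i : ℕ) < n}).height := by
  induction n with
  | zero => simp
  | succ n ih =>
    have hle : supportedIdeal P {i : Fin N | (i : ℕ) < n} ≤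
        supportedIdeal P {i : Fin N | (i : ℕ) < n + 1} :=
      supportedIdeal_mono P fun i (hi : (i : ℕ) < n) => Nat.lt_succ_of_lt hi
    by_cases h : ∃ i : Fin N, (i : ℕ) = n ∧ supportedIdeal P {l | l < i} ≠ supportedIdeal P {l | l ≤ i}
    · obtain ⟨i, rfl, hi⟩ := h
      have h1 : {l : Fin N | (l : ℕ) < i} = {l | l < i} := rfl
      have h2 : {l : Fin N | (l : ℕ) < i + 1} = {l | l ≤ i} := by
        ext l; simp
      have h3 := Ideal.height_add_one_le_of_lt_of_isPrime (lt_of_le_of_ne hle (by rwa [h1, h2]))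
      refine le_trans ?_ h3
      refine le_trans ?_ (add_le_add_left ih 1)
      norm_cast
      refine le_trans (Set.ncard_le_ncard (t := insert i _) ?_ (Set.toFinite _))
        (Set.ncard_insert_le _ _)
      rintro l ⟨hl, hl'⟩
      rcases Nat.lt_succ_iff_lt_or_eq.1 hl' with h4 | h4
      · exact Or.inr ⟨hl, h4⟩
      · exact Or.inl (Fin.ext h4)
    · refine le_trans ?_ (ih.trans (Ideal.height_mono hle))
      rw [Nat.cast_le]
      refine Set.ncard_le_ncard ?_ (Set.toFinite _)
      rintro l ⟨hl, hl'⟩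
      refine ⟨hl, (Nat.lt_succ_iff_lt_or_eq.1 hl').resolve_right fun h4 => h ⟨l, h4, hl⟩⟩

theorem eq_zero_of_mem_supported {P : Ideal (MvPolynomial (Fin N) K)} (hP : P.IsPrime) (n : ℕ)
    {f : MvPolynomial (Fin N) K} (hf : f ∈ P)
    (hfs : f ∈ supported K {i : Fin N | supportedIdeal P {l | l < i} = supportedIdeal P {l | l ≤ i} ∧
      (i : ℕ) < n}) : f = 0 := by
  classical
  induction n generalizing f with
  | zero =>
    simp only [Nat.not_lt_zero, and_false, Set.ofPred_false, supported_empty] at hfs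
    obtain ⟨c, rfl⟩ := Algebra.mem_bot.1 hfs
    by_contra h0
    refine hP.ne_top (Ideal.eq_top_of_isUnit_mem _ hf ?_)
    exact (isUnit_iff_ne_zero.2 fun h => h0 (by rw [h, map_zero])).map _
  | succ n ih =>
    by_cases h : ∃ i : Fin N, (i : ℕ) = n ∧ supportedIdeal P {l | l < i} = supportedIdeal P {l | l ≤ i}
    · obtain ⟨i, rfl, hi⟩ := h
      have h1 : f ∈ supportedIdeal P {l | l < i} := by
        rw [hi]
        refine Ideal.subset_span ⟨hf, supported_mono ?_ hfs⟩
        rintro l ⟨-, hl⟩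
        exact Nat.lt_succ_iff.1 hl
      refine asPolynomialIn_injective i ?_
      rw [map_zero]
      ext1 m
      rw [Polynomial.coeff_zero]
      refine ih (coeff_asPolynomialIn_mem (s := {l | l < i}) (lt_irrefl i) h1 m)
        (supported_mono ?_ (coeff_asPolynomialIn_mem_supported hfs m))
      rintro l ⟨⟨hl, hl'⟩, hl''⟩
      exact ⟨hl, (Nat.lt_succ_iff_lt_or_eq.1 hl').resolve_right fun h4 => hl'' (Fin.ext h4)⟩
    · refine ih hf (supported_mono ?_ hfs)
      rintro l ⟨hl, hl'⟩
      refine ⟨hl, (Nat.lt_succ_iff_lt_or_eq.1 hl').resolve_right fun h4 => h ⟨l, h4, hl⟩⟩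

/-- A prime ideal contains no nonzero polynomial in all but (height)-many suitable variables. -/
theorem exists_independent_variables {P : Ideal (MvPolynomial (Fin N) K)} (hP : P.IsPrime) :
    ∃ s : Set (Fin N), (s.ncard : ℕ∞) ≤ P.height ∧ ∀ f ∈ supported K sᶜ, f ∈ P → f = 0 := by
  have := fun n => supportedIdeal_isPrime hP {i : Fin N | (i : ℕ) < n}
  refine ⟨{i | supportedIdeal P {l | l < i} ≠ supportedIdeal P {l | l ≤ i}}, ?_, fun f hf hfP => ?_⟩
  · refine le_trans ?_ ((card_le_height_supportedIdeal N).trans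
      (Ideal.height_mono (supportedIdeal_le P _)))
    simp
  · refine eq_zero_of_mem_supported hP N hfP ?_
    convert hf using 2
    ext i
    simp

end

section
open IsLocalRing

theorem exists_finset_span_eq_maximalIdeal {A : Type*} [CommRing A] [IsLocalRing A]
    [IsNoetherianRing A] {r : ℕ} (f : Fin r → maximalIdeal A)
    (hf : LinearIndependent (ResidueField A) fun j => (maximalIdeal A).toCotangent (f j)) :
    ∃ t : Finset A, t.card + r ≤ Module.finrank (ResidueField A) (CotangentSpace A) ∧
      Ideal.span (Set.range (fun j => (f j : A)) ∪ t) = maximalIdeal A := by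
  classical
  have : Fintype (Fin r ⊕ Module.Basis.sumExtendIndex hf) :=
    FiniteDimensional.fintypeBasisIndex (Module.Basis.sumExtend hf)
  have : Fintype (Module.Basis.sumExtendIndex hf) :=
    Fintype.ofInjective (Sum.inr : _ → Fin r ⊕ Module.Basis.sumExtendIndex hf) Sum.inr_injective
  choose g hg using fun i : Module.Basis.sumExtendIndex hf =>
    (maximalIdeal A).toCotangent_surjective (Module.Basis.sumExtend hf (Sum.inr i))
  have hspan : Submodule.span A (Set.range f ∪ Set.range g) = ⊤ := by
    rw [← CotangentSpace.span_image_eq_top_iff, Set.image_union, ← Set.range_comp,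
      ← Set.range_comp, ← (Module.Basis.sumExtend hf).span_eq, ← Set.Sum.elim_range]
    congr 2
    funext i
    rcases i with i | i
    · rw [Sum.elim_inl, Module.Basis.sumExtend, Module.Basis.reindex_apply,
        Module.Basis.extend_apply_self]
      rfl
    · exact hg i
  refine ⟨Finset.univ.image fun i => (g i : A), ?_, ?_⟩
  · rw [Module.finrank_eq_nat_card_basis (Module.Basis.sumExtend hf), Nat.card_sum,
      Nat.card_eq_fintype_card, Fintype.card_fin, add_comm, Nat.card_eq_fintype_card]
    exact Nat.add_le_add_left Finset.card_image_le _
  · have h := congrArg (Submodule.map (maximalIdeal A).subtype) hspan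
    rw [Submodule.map_span, Submodule.map_top, Submodule.range_subtype, Set.image_union,
      ← Set.range_comp, ← Set.range_comp] at h
    rw [Finset.coe_image, Finset.coe_univ, Set.image_univ]
    exact h

theorem pderiv_mem_of_mem_sq {R : Type*} [CommRing R] {σ : Type*} {P : Ideal (MvPolynomial σ R)}
    (κ : σ) {f : MvPolynomial σ R} (hf : f ∈ P ^ 2) : pderiv κ f ∈ P := by
  rw [pow_two] at hf
  induction hf using Submodule.mul_induction_on' with
  | mem_mul_mem a ha b hb =>
    rw [Derivation.leibniz]
    exact P.add_mem (P.mul_mem_right _ ha) (P.mul_mem_right _ hb)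
  | add a _ b _ ha hb => rw [map_add]; exact P.add_mem ha hb

theorem mem_of_sum_mul_mem {R : Type*} [CommRing R] {P : Ideal R} (hP : P.IsPrime) {r : ℕ}
    {M : Matrix (Fin r) (Fin r) R} (hM : M.det ∉ P) {a : Fin r → R}
    (ha : ∀ l, ∑ j, a j * M j l ∈ P) (j : Fin r) : a j ∈ P := by
  have h : M.det * a j = ∑ l, (∑ i, a i * M i l) * M.adjugate l j := by
    have := congrFun (Matrix.vecMul_vecMul a M M.adjugate) j
    rw [Matrix.mul_adjugate, Matrix.vecMul_smul, Matrix.vecMul_one, Pi.smul_apply,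
      smul_eq_mul] at this
    rw [← this]
    rfl
  refine (hP.mem_or_mem (x := M.det) ?_).resolve_left hM
  rw [h]
  exact P.sum_mem fun l _ => P.mul_mem_right _ (ha l)

theorem linearIndependent_toCotangent_of_det_notMem {R : Type*} [CommRing R] {σ : Type*}
    (P : Ideal (MvPolynomial σ R)) [hP : P.IsPrime] {r : ℕ} {F : Fin r → MvPolynomial σ R}
    (hF : ∀ j, F j ∈ P) {κ : Fin r → σ}
    (hdet : (Matrix.of fun j l => pderiv (κ l) (F j)).det ∉ P) :
    LinearIndependent (ResidueField (Localization.AtPrime P)) fun j =>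
      (maximalIdeal (Localization.AtPrime P)).toCotangent
        ⟨algebraMap _ _ (F j), (IsLocalization.AtPrime.to_map_mem_maximal_iff _ P _).2 (hF j)⟩ := by
  rw [Fintype.linearIndependent_iff]
  intro c hc j
  choose c hc' using fun j => residue_surjective (c j)
  obtain rfl : _ = _ := funext hc'
  rw [residue_eq_zero_iff]
  obtain ⟨v, hv⟩ := IsLocalization.exist_integer_multiples P.primeCompl Finset.univ c
  choose a ha using fun j => hv j (Finset.mem_univ j)
  have h1 : (∑ j, c j * algebraMap _ (Localization.AtPrime P) (F j)) ∈
      maximalIdeal (Localization.AtPrime P) ^ 2 := by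
    have h2 : ∑ j, c j • (maximalIdeal (Localization.AtPrime P)).toCotangent
        ⟨algebraMap _ _ (F j),
          (IsLocalization.AtPrime.to_map_mem_maximal_iff _ P _).2 (hF j)⟩ = 0 := hc
    simp_rw [← map_smul, ← map_sum] at h2
    rw [Ideal.toCotangent_eq_zero] at h2
    simpa [AddSubmonoidClass.coe_finsetSum] using h2
  have h3 : algebraMap _ (Localization.AtPrime P) (∑ j, a j * F j) ∈
      (P ^ 2).map (algebraMap _ (Localization.AtPrime P)) := by
    rw [Ideal.map_pow, Localization.AtPrime.map_eq_maximalIdeal, map_sum]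
    have := Ideal.mul_mem_left _ (algebraMap (MvPolynomial σ R) (Localization.AtPrime P) v) h1
    rw [Finset.mul_sum] at this
    convert this using 2 with j
    rw [map_mul, ha, Algebra.smul_def, mul_assoc]
  obtain ⟨u, hu, hu'⟩ := (IsLocalization.algebraMap_mem_map_algebraMap_iff P.primeCompl
    (Localization.AtPrime P) _ _).1 h3
  have h4 : ∀ l, ∑ j, (u * a j) * pderiv (κ l) (F j) ∈ P := fun l => by
    have h5 := pderiv_mem_of_mem_sq (κ l) hu'
    rw [Finset.mul_sum, map_sum] at h5
    simp_rw [← mul_assoc] at h5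
    simp_rw [Derivation.leibniz, Finset.sum_add_distrib, smul_eq_mul] at h5
    refine (P.add_mem_iff_left (P.sum_mem fun j _ => P.mul_mem_right _ (hF j))).1 h5
  have h6 := (hP.mem_or_mem (mem_of_sum_mul_mem hP hdet h4 j)).resolve_left hu
  rw [← IsLocalization.AtPrime.to_map_mem_maximal_iff (Localization.AtPrime P) P, ha j,
    Algebra.smul_def] at h6
  refine ((maximalIdeal.isMaximal _).isPrime.mem_or_mem h6).resolve_left fun h => ?_
  exact v.2 ((IsLocalization.AtPrime.to_map_mem_maximal_iff _ P _).1 h)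

theorem height_comap_mk_le {R : Type*} [CommRing R] [IsNoetherianRing R] {r : ℕ} (F : Fin r → R)
    (P : Ideal (R ⧸ Ideal.span (Set.range F))) [P.IsPrime] :
    (P.comap (Ideal.Quotient.mk _)).height ≤ P.height + r := by
  have h := Ideal.height_le_height_add_encard_of_subset (Set.range F)
    (p := P.comap (Ideal.Quotient.mk _)) fun x hx => by
      rw [SetLike.mem_coe, Ideal.mem_comap,
        Ideal.Quotient.eq_zero_iff_mem.2 (Ideal.subset_span hx)]
      exact P.zero_mem
  rw [Ideal.map_comap_of_surjective _ Ideal.Quotient.mk_surjective] at h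
  refine h.trans (add_le_add_right ?_ _)
  rw [← Set.image_univ]
  exact (Set.encard_image_le _ _).trans (by simp)

theorem isRegularLocal_of_det_notMem {K : Type*} [Field K] {N r : ℕ}
    (F : Fin r → MvPolynomial (Fin N) K)
    (P : Ideal (MvPolynomial (Fin N) K ⧸ Ideal.span (Set.range F))) [P.IsPrime]
    {κ : Fin r → Fin N}
    (hdet : (Matrix.of fun j l => pderiv (κ l) (F j)).det ∉ P.comap (Ideal.Quotient.mk _)) :
    IsRegularLocal (Localization.AtPrime P) := by
  classical
  have hF : ∀ j, F j ∈ P.comap (Ideal.Quotient.mk _) := fun j => by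
    rw [Ideal.mem_comap, Ideal.Quotient.eq_zero_iff_mem.2 (Ideal.subset_span (Set.mem_range_self j))]
    exact P.zero_mem
  set Q := P.comap (Ideal.Quotient.mk (Ideal.span (Set.range F))) with hQ
  obtain ⟨t, ht, hspan⟩ := exists_finset_span_eq_maximalIdeal _
    (linearIndependent_toCotangent_of_det_notMem Q hF hdet)
  have hreg : IsRegularLocalRing (Localization.AtPrime Q) := inferInstance
  have hdim := (IsRegularLocalRing.iff_finrank_cotangentSpace _).1 hreg
  rw [IsLocalization.AtPrime.ringKrullDim_eq_height Q (Localization.AtPrime Q)] at hdim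
  set φ := Localization.localRingHom Q P (Ideal.Quotient.mk _) hQ with hφ
  have hmap : Ideal.span ((t.image φ : Finset _) : Set (Localization.AtPrime P)) =
      maximalIdeal (Localization.AtPrime P) := by
    have h1 : (maximalIdeal (Localization.AtPrime Q)).map φ =
        maximalIdeal (Localization.AtPrime P) := by
      rw [← Localization.AtPrime.map_eq_maximalIdeal, ← Localization.AtPrime.map_eq_maximalIdeal,
        Ideal.map_map]
      have h2 : φ.comp (algebraMap (MvPolynomial (Fin N) K) (Localization.AtPrime Q)) =
          (algebraMap _ (Localization.AtPrime P)).comp (Ideal.Quotient.mk (Ideal.span _)) :=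
        RingHom.ext fun x => Localization.localRingHom_to_map Q P _ hQ x
      rw [h2, ← Ideal.map_map, Ideal.map_comap_of_surjective _ Ideal.Quotient.mk_surjective]
    rw [← h1, ← hspan, Ideal.map_span, Set.image_union, Ideal.span_union, Finset.coe_image]
    refine (sup_eq_right.2 (Ideal.span_le.2 ?_)).symm
    rintro _ ⟨_, ⟨j, rfl⟩, rfl⟩
    rw [Localization.localRingHom_to_map,
      Ideal.Quotient.eq_zero_iff_mem.2 (Ideal.subset_span (Set.mem_range_self j)), map_zero]
    exact Ideal.zero_mem _
  refine ⟨inferInstance, t.image φ, hmap, le_antisymm ?_ ?_⟩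
  · rw [IsLocalization.AtPrime.ringKrullDim_eq_height P (Localization.AtPrime P)]
    have h2 := height_comap_mk_le F P
    rw [← hQ] at h2
    have h3 : (Module.finrank (ResidueField (Localization.AtPrime Q))
      (CotangentSpace (Localization.AtPrime Q)) : ℕ∞) = Q.height := by exact_mod_cast hdim
    rw [← h3] at h2
    have h4 : ((t.image φ).card : ℕ∞) ≤ P.height := by
      refine (Nat.cast_le.2 Finset.card_image_le).trans ?_
      have h5 : (t.card : ℕ∞) + r ≤ P.height + r := le_trans (by exact_mod_cast ht) h2
      exact (ENat.add_le_add_iff_right (ENat.natCast_ne_top r)).1 h5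
    exact_mod_cast h4
  · refine (ringKrullDim_le_spanFinrank_maximalIdeal _).trans ?_
    rw [← hmap]
    have := Submodule.spanFinrank_span_le_ncard_of_finite (R := Localization.AtPrime P)
      (t.image φ).finite_toSet
    rw [Set.ncard_coe_finset] at this
    exact_mod_cast this

end

section
open Filter

theorem HasCollapse.mono {K σ : Type*} [CommSemiring K] {e k k' : ℕ} {f : MvPolynomial σ K}
    (h : HasCollapse e k f) (hf : f ≠ 0) (hk : k ≤ k') : HasCollapse e k' f := by
  obtain ⟨G, d, hG, hGf⟩ := h
  rcases k with _ | k
  · refine absurd ?_ hf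
    simpa [Set.range_eq_empty] using hGf
  · refine ⟨fun i => if h : (i : ℕ) < k + 1 then G ⟨i, h⟩ else 0,
      fun i => if h : (i : ℕ) < k + 1 then d ⟨i, h⟩ else d 0, fun i => ?_, ?_⟩
    · by_cases h : (i : ℕ) < k + 1
      · simpa only [dif_pos h] using hG ⟨i, h⟩
      · simp only [dif_neg h]
        exact ⟨(hG 0).1, (hG 0).2.1, isHomogeneous_zero _ _ _⟩
    · refine Ideal.span_mono ?_ hGf
      rintro _ ⟨i, rfl⟩
      exact ⟨⟨i, i.2.trans_le hk⟩, dif_pos i.2⟩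

theorem HasCollapse.zero {K σ : Type*} [CommSemiring K] (e : ℕ) :
    HasCollapse e 0 (0 : MvPolynomial σ K) :=
  ⟨Fin.elim0, Fin.elim0, fun i => i.elim0, Ideal.zero_mem _⟩

theorem HasCollapse.add {K σ : Type*} [CommSemiring K] {e k k' : ℕ} {f g : MvPolynomial σ K}
    (hf : HasCollapse e k f) (hg : HasCollapse e k' g) : HasCollapse e (k + k') (f + g) := by
  obtain ⟨G, d, hG, hGf⟩ := hf
  obtain ⟨G', d', hG', hGf'⟩ := hg
  refine ⟨Fin.append G G', Fin.append d d', fun i => ?_, ?_⟩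
  · induction i using Fin.addCases with
    | left i => simpa only [Fin.append_left] using hG i
    | right i => simpa only [Fin.append_right] using hG' i
  · refine Ideal.add_mem _ (Ideal.span_mono ?_ hGf) (Ideal.span_mono ?_ hGf')
    · rintro _ ⟨i, rfl⟩
      exact ⟨Fin.castAdd k' i, Fin.append_left _ _ _⟩
    · rintro _ ⟨i, rfl⟩
      exact ⟨Fin.natAdd k i, Fin.append_right _ _ _⟩

theorem MvPolynomial.IsHomogeneous.hasCollapse_mul {K σ : Type*} [CommSemiring K] {e d : ℕ}
    {f : MvPolynomial σ K} (hf : f.IsHomogeneous d) (hd : 0 < d) (hde : d < e)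
    (g : MvPolynomial σ K) : HasCollapse e 1 (f * g) :=
  ⟨fun _ => f, fun _ => d, fun _ => ⟨hd, hde, hf⟩,
    Ideal.mul_mem_right _ _ (Ideal.subset_span ⟨0, rfl⟩)⟩

namespace Ultraprod

variable {𝒰 : Ultrafilter ℕ} {K : ℕ → Type u} [∀ i, Field (K i)] {N : ℕ → ℕ}

theorem exists_eventually_hasCollapse {e : ℕ} {f : ∀ i, MvPolynomial (Fin (N i)) (K i)}
    (hf : mk 𝒰 f ∈ decomposables (form 𝒰 K N) e) :
    ∃ k, ∀ᶠ i in 𝒰, HasCollapse e k (f i) := by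
  have key : ∀ a ∈ decomposables (form 𝒰 K N) e, ∃ k, ∃ g : ∀ i, MvPolynomial (Fin (N i)) (K i),
      mk 𝒰 g = a ∧ ∀ᶠ i in 𝒰, HasCollapse e k (g i) := by
    have hadd : ∀ a b : Poly 𝒰 K N,
        (∃ k, ∃ g : ∀ i, MvPolynomial (Fin (N i)) (K i),
          mk 𝒰 g = a ∧ ∀ᶠ i in 𝒰, HasCollapse e k (g i)) →
        (∃ k, ∃ g : ∀ i, MvPolynomial (Fin (N i)) (K i),
          mk 𝒰 g = b ∧ ∀ᶠ i in 𝒰, HasCollapse e k (g i)) →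
        ∃ k, ∃ g : ∀ i, MvPolynomial (Fin (N i)) (K i),
          mk 𝒰 g = a + b ∧ ∀ᶠ i in 𝒰, HasCollapse e k (g i) := by
      rintro _ _ ⟨k, g, rfl, hg⟩ ⟨k', g', rfl, hg'⟩
      refine ⟨k + k', g + g', map_add _ _ _, ?_⟩
      filter_upwards [hg, hg'] with i h h' using h.add h'
    intro a ha
    refine Submodule.iSup_induction _ (motive := fun a => ∃ k,
      ∃ g : ∀ i, MvPolynomial (Fin (N i)) (K i),
        mk 𝒰 g = a ∧ ∀ᶠ i in 𝒰, HasCollapse e k (g i)) ha ?_ ?_ hadd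
    · rintro ⟨⟨p, q⟩, hp, hq, hpq⟩ x hx
      refine Submodule.mul_induction_on hx ?_ hadd
      intro x hx y hy
      obtain ⟨x, rfl⟩ := mk_surjective x
      obtain ⟨y, rfl⟩ := mk_surjective y
      refine ⟨1, x * y, map_mul _ _ _, ?_⟩
      filter_upwards [mk_mem_form.1 hx] with i h
      exact h.hasCollapse_mul hp (by dsimp at hpq hq ⊢; omega) _
    · exact ⟨0, 0, map_zero _, Eventually.of_forall fun i => HasCollapse.zero e⟩
  obtain ⟨k, g, hgf, hg⟩ := key _ hf
  refine ⟨k, ?_⟩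
  filter_upwards [mk_eq_mk.1 hgf, hg] with i h h'
  exact h ▸ h'

end Ultraprod
end

section
open Filter

theorem IsCoordinateFamily.exists_det_notMem {k J : Type u} [Field k] [IsAlgClosed k]
    {w : J → ℕ} {ι : Type*} {D : ι → Derivation k (MvPolynomial J k) (MvPolynomial J k)}
    (hD : IsCoordinateFamily w D) {P : Ideal (MvPolynomial J k)} (hP : P.IsPrime) (hfg : P.FG)
    {r : ℕ} {g : Fin r → J} (hg : Function.Injective g) :
    ∃ κ : Fin r → ι, (Matrix.of fun j l => D (κ l) (X (g j))).det ∉ P := by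
  classical
  have : IsDomain (MvPolynomial J k ⧸ P) := (Ideal.Quotient.isDomain_iff_prime P).2 hP
  obtain ⟨κ, hκ⟩ := exists_det_ne_zero
    (fun (j : Fin r) (κ : ι) => Ideal.Quotient.mk P (D κ (X (g j)))) fun a ha j => by
      choose b hb using fun j => Ideal.Quotient.mk_surjective (a j)
      obtain rfl : _ = a := funext hb
      have h1 := hD.mem_of_sum_mem hP hfg (s := Finset.univ.image g)
        (a := Function.extend g b 0) (fun κ => by
          rw [Finset.sum_image hg.injOn, ← Ideal.Quotient.eq_zero_iff_mem, map_sum, ← ha κ]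
          simp_rw [hg.extend_apply, map_mul])
        (g j) (Finset.mem_image_of_mem _ (Finset.mem_univ j))
      rw [hg.extend_apply] at h1
      exact Ideal.Quotient.eq_zero_iff_mem.2 h1
  refine ⟨κ, fun h => hκ ?_⟩
  rw [← Ideal.Quotient.eq_zero_iff_mem, RingHom.map_det] at h
  exact h

namespace Ultraprod

variable {𝒰 : Ultrafilter ℕ} {K : ℕ → Type u} [∀ i, Field (K i)] {N : ℕ → ℕ}

theorem linearIndepOn_decomposables {r : ℕ} {δ : Fin r → ℕ}
    {F : ∀ i, Fin r → MvPolynomial (Fin (N i)) (K i)}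
    (hF : ∀ k, ∀ᶠ i in 𝒰, ∀ (a : Fin r → K i) (e : ℕ), (∃ j, δ j = e ∧ a j ≠ 0) →
      ¬ HasCollapse e k (∑ j with δ j = e, a j • F i j)) (e : ℕ) :
    LinearIndepOn (Ultraprod 𝒰 K)
      (fun j => (decomposables (form 𝒰 K N) e).mkQ (mk 𝒰 fun i => F i j)) {j | δ j = e} := by
  classical
  have hset : {j | δ j = e} = ((Finset.univ.filter fun j => δ j = e : Finset (Fin r)) :
    Set (Fin r)) := by simp
  rw [hset, linearIndepOn_finset_iff]
  intro g hg j hj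
  by_contra hgj
  choose c hc using fun j => mk_surjective (𝒰 := 𝒰) (g j)
  have h1 : (mk 𝒰 fun i => ∑ j with δ j = e, c j i • F i j) ∈
      decomposables (form 𝒰 K N) e := by
    rw [← Submodule.ker_mkQ (decomposables (form 𝒰 K N) e), LinearMap.mem_ker, ← hg, ← mk_sum,
      map_sum]
    refine Finset.sum_congr rfl fun j _ => ?_
    rw [← map_smul, ← hc, mk_smul_mk]
  obtain ⟨k, hk⟩ := exists_eventually_hasCollapse h1
  have h2 : ∀ᶠ i in 𝒰, c j i ≠ 0 := by
    rw [Ultrafilter.eventually_not, ← mk_eq_zero, hc]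
    exact hgj
  obtain ⟨i, h3, h4, h5⟩ := (hk.and (h2.and (hF k))).exists
  exact h5 (fun j => c j i) e ⟨j, by simpa using hj, h4⟩ h3

theorem exists_eventually_det_notMem [∀ i, IsAlgClosed (K i)] [∀ i, NeZero (N i)] {r m : ℕ}
    {δ : Fin r → ℕ} (hδ : ∀ j, 0 < δ j) {F : ∀ i, Fin r → MvPolynomial (Fin (N i)) (K i)}
    (hδF : ∀ i j, (F i j).IsHomogeneous (δ j))
    (hF : ∀ k, ∀ᶠ i in 𝒰, ∀ (a : Fin r → K i) (e : ℕ), (∃ j, δ j = e ∧ a j ≠ 0) →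
      ¬ HasCollapse e k (∑ j with δ j = e, a j • F i j))
    {P : ∀ i, Ideal (MvPolynomial (Fin (N i)) (K i))} (hP : ∀ i, (P i).IsPrime)
    {κ : Fin m → ∀ i, Fin (N i)}
    (hκ : ∀ i, ∀ f ∈ supported (K i) (Set.range fun l => κ l i)ᶜ, f ∈ P i → f = 0) :
    ∃ μ : Fin r → ∀ i, Fin (N i),
      ∀ᶠ i in 𝒰, (Matrix.of fun j l => pderiv (μ l i) (F i j)).det ∉ P i := by
  obtain ⟨J, w, y, g, hg, hwg, hyg, hy⟩ := exists_isGeneratingSystem (form 𝒰 K N)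
    (fun j => mk 𝒰 fun i => F i j) δ hδ
    (fun j => mk_mem_form.2 (Eventually.of_forall fun i => hδF i j))
    (linearIndepOn_decomposables hF)
  obtain ⟨D, hDX, hD⟩ := exists_derivation hy
  let Φ : MvPolynomial J (Ultraprod 𝒰 K) →ₐ[Ultraprod 𝒰 K] Poly 𝒰 K N := aeval y
  have hprime : ((internalIdeal 𝒰 P).comap Φ).IsPrime :=
    have := internalIdeal_isPrime (𝒰 := 𝒰) hP
    Ideal.comap_isPrime _ _
  obtain ⟨x, hx⟩ := exists_mk_X hy κ
  have hfg : ((internalIdeal 𝒰 P).comap Φ).FG := by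
    refine fg_of_disjoint hprime (constants y κ) x (adjoin_constants_eq_top hy κ hx) ?_
    intro a ha ha'
    obtain ⟨f, hf⟩ := mk_surjective (𝒰 := 𝒰) (aeval y a)
    rw [mem_constants hf] at ha
    rw [Ideal.mem_comap, ← hf, mk_mem_internalIdeal] at ha'
    refine aeval_injective hy ?_
    rw [map_zero, ← hf, mk_eq_zero]
    filter_upwards [ha, ha'] with i h h' using hκ i _ h h'
  obtain ⟨μ, hμ⟩ := (isCoordinateFamily hy hDX hD).exists_det_notMem hprime hfg hg
  refine ⟨μ, ?_⟩
  rw [Ultrafilter.eventually_not, ← mk_mem_internalIdeal]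
  rw [Ideal.mem_comap] at hμ
  convert hμ using 2
  rw [AlgHom.map_det]
  have h1 : (AlgHom.mapMatrix (aeval y)) (Matrix.of fun j l => D (μ l) (X (g j))) =
      (mk 𝒰).mapMatrix (Matrix.of fun j l => fun i => pderiv (μ l i) (F i j)) := by
    ext j l
    simp only [AlgHom.mapMatrix_apply, RingHom.mapMatrix_apply, Matrix.map_apply,
      Matrix.of_apply]
    rw [hD, aeval_X, hyg, partialDeriv, mapDerivation_mk]
  rw [h1, ← RingHom.map_det]
  congr 1
  funext i
  have h2 := (Pi.evalRingHom (fun i => MvPolynomial (Fin (N i)) (K i)) i).map_det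
    (Matrix.of fun j l => fun i => pderiv (μ l i) (F i j))
  exact h2.symm

end Ultraprod

theorem exists_det_notMem_of_not_hasCollapse {r m : ℕ} {δ : Fin r → ℕ} (hδ : ∀ j, 0 < δ j) :
    ∃ c : ℕ, ∀ (K : Type u) [Field K] [IsAlgClosed K] (N : ℕ)
      (F : Fin r → MvPolynomial (Fin N) K), (∀ j, (F j).IsHomogeneous (δ j)) →
      (∀ (a : Fin r → K) (e : ℕ), (∃ j, δ j = e ∧ a j ≠ 0) →
        ∑ j with δ j = e, a j • F j ≠ 0 ∧ ¬ HasCollapse e c (∑ j with δ j = e, a j • F j)) →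
      ∀ P : Ideal (MvPolynomial (Fin N) K), P.IsPrime →
      ∀ κ : Fin m → Fin N, (∀ f ∈ supported K (Set.range κ)ᶜ, f ∈ P → f = 0) →
      ∃ μ : Fin r → Fin N, (Matrix.of fun j l => pderiv (μ l) (F j)).det ∉ P := by
  classical
  by_contra! h
  choose K hK hK' N F hδF hF P hP κ hκ hdet using h
  rcases r with _ | r
  · refine (hP 0).ne_top ((Ideal.eq_top_iff_one _).2 ?_)
    simpa using hdet 0 Fin.elim0
  have hN : ∀ i, NeZero (N i) := fun i => by
    refine ⟨fun hN => ?_⟩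
    have : IsEmpty (Fin (N i)) := by rw [hN]; infer_instance
    refine (hF i 1 (δ 0) ⟨0, rfl, one_ne_zero⟩).1 ?_
    refine Finset.sum_eq_zero fun j _ => ?_
    obtain ⟨a, ha⟩ := C_surjective (R := K i) (Fin (N i)) (F i j)
    have h1 := hδF i j
    rw [← ha] at h1 ⊢
    by_contra h2
    have h3 : C a ≠ 0 := fun h => h2 (by rw [h, smul_zero])
    exact (hδ j).ne (IsHomogeneous.inj_right (isHomogeneous_C _ a) h1 h3)
  obtain ⟨μ, hμ⟩ := Ultraprod.exists_eventually_det_notMem (𝒰 := hyperfilter ℕ) (N := N) hδ hδF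
    (fun k => by
      have h1 : ∀ᶠ i in (hyperfilter ℕ : Filter ℕ), k ≤ i :=
        (Nat.hyperfilter_le_atTop (eventually_ge_atTop k))
      filter_upwards [h1] with i hi a e ha hc
      exact (hF i a e ha).2 (hc.mono (hF i a e ha).1 hi))
    hP (κ := fun l i => κ i l) hκ
  obtain ⟨i, hi⟩ := hμ.exists
  exact hi (hdet i fun l => μ l i)

end

theorem exists_basis_of_graded {K M : Type*} [Field K] [AddCommGroup M] [Module K M] {d : ℕ}
    (V : Fin d → Submodule K M) [∀ i, FiniteDimensional K (V i)] :
    ∃ (r : ℕ) (δ : Fin r → Fin d) (F : Fin r → M), r = ∑ i, Module.finrank K (V i) ∧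
      (∀ j, F j ∈ V (δ j)) ∧
      (∀ (i : Fin d) (a : Fin r → K), (∃ j, δ j = i ∧ a j ≠ 0) →
        ∑ j with δ j = i, a j • F j ≠ 0) ∧
      ⨆ i, V i ≤ Submodule.span K (Set.range F) := by
  classical
  obtain ⟨r, hr, ⟨e⟩⟩ : ∃ r, r = ∑ i, Module.finrank K (V i) ∧
      Nonempty (Fin r ≃ Σ i, Fin (Module.finrank K (V i))) :=
    ⟨_, rfl, ⟨finSigmaFinEquiv.symm⟩⟩
  let b := fun i => Module.finBasis K (V i)
  let φ : (Σ i, Fin (Module.finrank K (V i))) → M := fun p => b p.1 p.2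
  refine ⟨r, fun j => (e j).1, fun j => φ (e j), hr, fun j => Subtype.prop _,
    ?_, iSup_le fun i => ?_⟩
  · rintro i a ⟨j, rfl, haj⟩ h
    refine haj ?_
    have h1 : ∑ l, a (e.symm ⟨(e j).1, l⟩) • b (e j).1 l = 0 := by
      refine Subtype.ext ?_
      rw [ZeroMemClass.coe_zero, ← h, Finset.sum_filter, ← e.symm.sum_comp, Fintype.sum_sigma,
        Fintype.sum_eq_single (e j).1]
      · simp [φ]
      · intro i hi
        simp [hi]
    have h2 := Fintype.linearIndependent_iff.1 (b (e j).1).linearIndependent _ h1 (e j).2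
    simpa using h2
  · have h1 := congrArg (Submodule.map (V i).subtype) (b i).span_eq
    rw [Submodule.map_span, Submodule.map_top, Submodule.range_subtype, ← Set.range_comp] at h1
    rw [← h1]
    refine Submodule.span_mono ?_
    rintro _ ⟨l, rfl⟩
    refine Set.mem_range.2 ⟨e.symm ⟨i, l⟩, ?_⟩
    rw [e.apply_symm_apply]
    rfl

theorem span_coe_iSup_eq {K A : Type*} [Field K] [CommRing A] [Algebra K A] {d r : ℕ}
    {V : Fin d → Submodule K A} {δ : Fin r → Fin d} {F : Fin r → A} (hF : ∀ j, F j ∈ V (δ j))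
    (hV : ⨆ i, V i ≤ Submodule.span K (Set.range F)) :
    Ideal.span ((⨆ i, V i : Submodule K A) : Set A) = Ideal.span (Set.range F) := by
  refine le_antisymm (Ideal.span_le.2 fun f hf => ?_) (Ideal.span_mono ?_)
  · exact Submodule.span_le_restrictScalars K A _ (hV hf)
  · rintro _ ⟨j, rfl⟩
    exact Submodule.mem_iSup_of_mem _ (hF j)

/-- For all positive `η`, `n`, `d` there is an integer `cA`, independent of
`N` and `K`, such that for every algebraically closed field `K` and every graded subspace `V`
of `K[x_1, …, x_N]` of dimension at most `n` spanned by forms of positive degree at most `d`,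
if no nonzero homogeneous element of `V` lies in an ideal generated by `cA` forms of strictly
lower positive degree, then the quotient by the ideal generated by `V` satisfies Serre's
condition `R_η`. -/
theorem statement3 (η n d : ℕ) (hη : 0 < η) (hn : 0 < n) (hd : 0 < d) :
    ∃ cA : ℕ,
      ∀ (K : Type u) [Field K] [IsAlgClosed K] (N : ℕ)
        (V : Fin d → Submodule K (MvPolynomial (Fin N) K)),
        (∀ i, V i ≤ homogeneousSubmodule (Fin N) K ((i : ℕ) + 1)) →
        (∀ i, FiniteDimensional K (V i)) →
        (∑ i, Module.finrank K (V i)) ≤ n →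
        (∀ i : Fin d, ∀ F ∈ V i, F ≠ 0 → ¬ HasCollapse ((i : ℕ) + 1) cA F) →
        SerreConditionR η
          (MvPolynomial (Fin N) K ⧸
            Ideal.span ((⨆ i, V i : Submodule K (MvPolynomial (Fin N) K)) :
              Set (MvPolynomial (Fin N) K))) := by
  classical
  choose c hc using fun (r m : ℕ) (δ : Fin r → Fin d) =>
    exists_det_notMem_of_not_hasCollapse.{u} (m := m) (δ := fun j => (δ j : ℕ) + 1)
      fun j => Nat.succ_pos _
  refine ⟨(Finset.range (n + 1)).sup fun r => (Finset.range (η + n + 1)).sup fun m =>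
    Finset.univ.sup fun δ => c r m δ, ?_⟩
  intro K _ _ N V hV hfin hdim hcol
  obtain ⟨r, δ, F, hr, hF, hne, hspan⟩ := exists_basis_of_graded V
  rw [← hr] at hdim
  rw [span_coe_iSup_eq hF hspan]
  intro P hP hPη
  by_contra hreg
  have hdet := fun κ : Fin r → Fin N => not_imp_comm.1
    (isRegularLocal_of_det_notMem F P (κ := κ)) hreg
  have hprime : (P.comap (Ideal.Quotient.mk (Ideal.span (Set.range F)))).IsPrime :=
    Ideal.comap_isPrime _ _
  obtain ⟨s, hs, hsP⟩ := exists_independent_variables hprime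
  have hm : s.ncard ≤ η + n := by
    have h1 : P.height ≤ η := (PrimeSpectrum.height_eq_orderHeight ⟨P, hP⟩).trans_le hPη
    have h2 : (s.ncard : ℕ∞) ≤ (η + r : ℕ) := by
      rw [Nat.cast_add]
      exact hs.trans ((height_comap_mk_le F P).trans (by gcongr))
    exact (Nat.cast_le.1 h2).trans (by omega)
  let ε : Fin s.ncard ≃ s := (Finite.equivFin s).symm
  have hε : Set.range (fun l => (ε l : Fin N)) = s := by
    rw [← Function.comp_def, ε.surjective.range_comp, Subtype.range_coe]
  obtain ⟨μ, hμ⟩ := hc r s.ncard δ K N F (fun j => hV _ (hF j)) (fun a e => by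
      rintro ⟨j, rfl, haj⟩
      have h1 : (Finset.univ.filter fun l => (δ l : ℕ) + 1 = (δ j : ℕ) + 1) =
          Finset.univ.filter fun l => δ l = δ j :=
        Finset.filter_congr fun l _ => by rw [Nat.succ_inj, Fin.val_inj]
      rw [h1]
      have h2 := hne (δ j) a ⟨j, rfl, haj⟩
      refine ⟨h2, fun h => hcol (δ j) _ (Submodule.sum_mem _ fun l hl => ?_) h2 (h.mono h2 ?_)⟩
      · exact Submodule.smul_mem _ _ ((Finset.mem_filter.1 hl).2 ▸ hF l)
      · refine le_trans ?_ (Finset.le_sup (Finset.mem_range.2 (Nat.lt_succ_of_le hdim)))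
        refine le_trans ?_ (Finset.le_sup (Finset.mem_range.2 (Nat.lt_succ_of_le hm)))
        exact Finset.le_sup (f := fun δ => c r s.ncard δ) (Finset.mem_univ δ))
    _ hprime (fun l => ε l) (by rw [hε]; exact hsP)
  exact hμ (hdet μ)
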